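/- arXiv:2309.11618 — 2 statements merged into one kernel-verified Lean document; each statement's English description precedes it below -/
import Mathlib

section
/- Let n ≥ 6. Then, as polynomials in x, P_{[2,n−2],[1,n−1]}(x) = (n−1) · x · [ binom(x+n−1, n−1) + binom(x−1, n−1) − binom(x+1, n−1) − binom(x+n−3, n−1) ], where [1,n−1] is the partition of n with one part 1 and one part n−1. -/
open Polynomial
open scoped Classical

/-- The cycle type of a permutation of `Fin n` as a partition of `n`,
including fixed points as parts equal to `1`. -/
noncomputable def fullCycleType {n : ℕ} (σ : Equiv.Perm (Fin n)) : Multiset ℕ :=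
  σ.cycleType + Multiset.replicate (n - σ.cycleType.sum) 1

/-- The number of disjoint cycles of a permutation, fixed points included. -/
noncomputable def numCycles {n : ℕ} (σ : Equiv.Perm (Fin n)) : ℕ :=
  Multiset.card (fullCycleType σ)

/-- The set (conjugacy class) of permutations of `Fin n` with full cycle type `β`. -/
noncomputable def permClass (n : ℕ) (β : Multiset ℕ) : Finset (Equiv.Perm (Fin n)) :=
  Finset.univ.filter (fun ω => fullCycleType ω = β)

/-- The polynomial `P_{[2,n-2],β}(x) = (n(n-1)/|C_β|) ⬝ Σ_{ρ(ω)=β} x^{κ(αω)}`. -/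
noncomputable def Pperm {n : ℕ} (α : Equiv.Perm (Fin n)) (β : Multiset ℕ) : Polynomial ℚ :=
  Polynomial.C (((n : ℚ) * ((n : ℚ) - 1)) / ((permClass n β).card : ℚ)) *
    ∑ ω ∈ permClass n β, Polynomial.X ^ (numCycles (α * ω))

/-- The polynomial `binom(x + c, k)` in `x`: for `k ≥ 0` it is
`(x+c)(x+c-1)⋯(x+c-k+1)/k!`, and it is `0` for `k < 0`. -/
noncomputable def binomPoly (c k : ℤ) : Polynomial ℚ :=
  if 0 ≤ k then
    (((k.toNat).factorial : ℚ))⁻¹ •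
      ((descPochhammer ℚ k.toNat).comp (Polynomial.X + Polynomial.C (c : ℚ)))
  else 0

/-- The signless Stirling number of the first kind: the number of permutations of
an `N`-element set with exactly `m` cycles (fixed points included). -/
noncomputable def stirling1 (N m : ℕ) : ℕ :=
  (Finset.univ.filter (fun σ : Equiv.Perm (Fin N) => numCycles σ = m)).card

/-- For a Young diagram with row lengths `L` (rows and columns 0-indexed),
the product `∏_{u} (t + c(u))` over the cells `u`, `c(u)` being the content. -/
def contentProd (L : List ℕ) (t : ℤ) : ℤ :=
  ∏ i ∈ Finset.range L.length, ∏ j ∈ Finset.range (L.getD i 0), (t + (j : ℤ) - (i : ℤ))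

/-- `C(a, b)` for an integer `b`: the usual binomial coefficient when `b ≥ 0`
(which is `0` for `b > a`), and `0` when `b < 0`. -/
def chooseZ (a : ℕ) (b : ℤ) : ℚ := if 0 ≤ b then (a.choose b.toNat : ℚ) else 0

section
open Equiv Equiv.Perm

variable {ι κ : Type*} [Fintype ι] [DecidableEq ι] [Fintype κ] [DecidableEq κ]

/-- The cycle type of a permutation of a finite type, fixed points included. -/
def Equiv.Perm.fullType (σ : Perm ι) : Multiset ℕ :=
  σ.cycleType + Multiset.replicate (Fintype.card ι - σ.cycleType.sum) 1

theorem Equiv.Perm.sum_fullType (σ : Perm ι) : σ.fullType.sum = Fintype.card ι := by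
  have := σ.sum_cycleType_le
  simp [fullType]; omega

theorem Equiv.Perm.fullType_permCongr (e : ι ≃ κ) (σ : Perm ι) :
    (e.permCongr σ).fullType = σ.fullType := by
  have h : e.permCongr σ =
      σ.extendDomain
        (e.trans (Equiv.subtypeUnivEquiv (p := fun _ : κ => True) (by simp)).symm) := by
    ext x
    rw [Equiv.Perm.extendDomain_apply_subtype _ _ trivial]
    simp
  simp only [fullType, h, cycleType_extendDomain, Fintype.card_congr e]

theorem Equiv.Perm.fullType_optionCongr (σ : Perm ι) :
    fullType (optionCongr σ) = 1 ::ₘ σ.fullType := by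
  have h : optionCongr σ = σ.extendDomain (optionIsSomeEquiv ι).symm := by
    ext x : 1
    rcases x with _ | x
    · rw [Equiv.Perm.extendDomain_apply_not_subtype _ _ (by simp)]
      simp
    · rw [Equiv.Perm.extendDomain_apply_subtype _ _ (by simp)]
      simp [optionIsSomeEquiv]
  have := σ.sum_cycleType_le
  simp only [fullType, h, cycleType_extendDomain, Fintype.card_option]
  rw [Nat.sub_add_comm this, Multiset.replicate_succ, Multiset.add_cons]

theorem Equiv.Perm.exists_fullType_swap_mul (σ : Perm ι) (i : ι) (hi : σ i ≠ i) :
    ∃ r : Multiset ℕ, σ.fullType = (σ.cycleOf i).support.card ::ₘ r ∧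
      fullType (swap i (σ i) * σ) = 1 ::ₘ ((σ.cycleOf i).support.card - 1) ::ₘ r := by
  set c := σ.cycleOf i with hc
  have hcyc : c.IsCycle := isCycle_cycleOf σ hi
  have hmem : c ∈ σ.cycleFactorsFinset := cycleOf_mem_cycleFactorsFinset_iff.2 (by simpa using hi)
  have hci : c i = σ i := cycleOf_apply_self σ i
  set ρ := σ * c⁻¹ with hρ
  have hdis : Disjoint ρ c := disjoint_mul_inv_of_mem_cycleFactorsFinset hmem
  have hσ : σ = c * ρ := by rw [← hdis.commute.eq]; simp [hρ]
  have hct : σ.cycleType = {c.support.card} + ρ.cycleType := by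
    conv_lhs => rw [hσ]
    rw [hdis.symm.cycleType_mul, hcyc.cycleType]
  have hmul : swap i (σ i) * σ = (swap i (c i) * c) * ρ := by rw [mul_assoc, ← hσ, hci]
  have h2 : 2 ≤ c.support.card := hcyc.two_le_card_support
  have hle := σ.sum_cycleType_le
  rw [hct] at hle
  simp only [Multiset.sum_add, Multiset.sum_singleton] at hle
  refine ⟨ρ.cycleType + Multiset.replicate (Fintype.card ι - σ.cycleType.sum) 1, ?_, ?_⟩
  · simp [fullType, hct]
  · by_cases hcc : c (c i) = i
    · have hsw := hcyc.eq_swap_of_apply_apply_eq_self (by rw [hci]; exact hi) hcc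
      have h1 : swap i (c i) * c = 1 := by
        rw [hsw]; simp
      have hcard : c.support.card = 2 := by
        rw [hsw]; exact card_support_swap (by rw [hci]; exact hi.symm)
      rw [hmul, h1, one_mul, fullType, hct, hcard]
      simp only [Multiset.sum_add, Multiset.sum_singleton]
      rw [hcard] at hle
      rw [show Fintype.card ι - ρ.cycleType.sum = Fintype.card ι - (2 + ρ.cycleType.sum) + 1 + 1 by
        omega]
      simp [Multiset.replicate_succ]
    · have hd : (swap i (c i) * c).IsCycle := hcyc.swap_mul (by rw [hci]; exact hi) hcc
      have hs := support_swap_mul_eq c i hcc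
      have hcard : (swap i (c i) * c).support.card = c.support.card - 1 := by
        rw [hs, Finset.card_sdiff_of_subset (by simpa [hci] using hi)]; simp
      have hdis' : Disjoint (swap i (c i) * c) ρ := by
        rw [disjoint_iff_disjoint_support, hs]
        exact (disjoint_iff_disjoint_support.1 hdis.symm).mono_left Finset.sdiff_subset
      rw [hmul, fullType, hdis'.cycleType_mul, hd.cycleType, hcard, hct]
      simp only [Multiset.sum_add, Multiset.sum_singleton]
      rw [show Fintype.card ι - (c.support.card - 1 + ρ.cycleType.sum) =
        Fintype.card ι - (c.support.card + ρ.cycleType.sum) + 1 by omega]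
      simp [Multiset.replicate_succ]

/-- The number of cycles of a permutation of a finite type, fixed points included. -/
def Equiv.Perm.cycleCount (σ : Perm ι) : ℕ := σ.fullType.card

theorem Equiv.Perm.cycleCount_optionCongr (σ : Perm ι) :
    cycleCount (optionCongr σ) = σ.cycleCount + 1 := by
  simp [cycleCount, fullType_optionCongr]

theorem Equiv.Perm.cycleCount_swap_mul (σ : Perm ι) (i : ι) (hi : σ i ≠ i) :
    cycleCount (swap i (σ i) * σ) = σ.cycleCount + 1 := by
  obtain ⟨r, h1, h2⟩ := exists_fullType_swap_mul σ i hi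
  simp [cycleCount, h1, h2]

theorem Equiv.Perm.cycleCount_swap_some_mul_optionCongr (σ : Perm ι) (b : ι) :
    cycleCount (swap none (some b) * optionCongr σ) = σ.cycleCount := by
  have h := cycleCount_swap_mul (swap none (some b) * optionCongr σ) none (by simp)
  simp [← mul_assoc, cycleCount_optionCongr] at h
  omega

/-- Each cycle length `ℓ` is attained at exactly `ℓ` moved points per cycle. -/
theorem Equiv.Perm.sum_card_support_cycleOf {M : Type*} [AddCommMonoid M] (σ : Perm ι) (g : ℕ → M) :
    ∑ i ∈ σ.support, g (σ.cycleOf i).support.card = (σ.cycleType.map fun l => l • g l).sum := by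
  rw [← Finset.sum_fiberwise_of_maps_to (t := σ.cycleFactorsFinset) (g := fun i => σ.cycleOf i)
    (fun i hi => cycleOf_mem_cycleFactorsFinset_iff.2 hi)]
  rw [cycleType_def, Multiset.map_map]
  refine Finset.sum_congr rfl fun c hc => ?_
  have : σ.support.filter (fun i => σ.cycleOf i = c) = c.support := by
    ext i
    simp only [Finset.mem_filter]
    constructor
    · rintro ⟨hi, rfl⟩
      simpa using hi
    · intro hi
      exact ⟨mem_cycleFactorsFinset_support_le hc hi, (cycle_is_cycleOf hi hc).symm⟩
  rw [this, Finset.sum_congr rfl (g := fun _ => g c.support.card)]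
  · simp
  · intro i hi
    rw [← cycle_is_cycleOf hi hc]

end

section
open Equiv Equiv.Perm Matrix

universe u

theorem Equiv.Perm.sum_perm_option {ι M : Type*} [Fintype ι] [DecidableEq ι] [AddCommMonoid M]
    (φ : Perm (Option ι) → M) :
    ∑ τ, φ τ = ∑ σ : Perm ι, (φ (optionCongr σ) + ∑ b, φ (swap none (some b) * optionCongr σ)) := by
  rw [← decomposeOption.symm.sum_comp, Fintype.sum_prod_type_right]
  refine Finset.sum_congr rfl fun σ _ => ?_
  simp only [Fintype.sum_option, decomposeOption_symm_apply, swap_self, ← one_def, one_mul]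

theorem Equiv.Perm.sum_sign_mul_pow_cycleCount (x : ℚ) (ι : Type*) [Fintype ι] [DecidableEq ι] :
    ∑ σ : Perm ι, ((sign σ : ℤ) : ℚ) * x ^ σ.cycleCount =
      ∏ i ∈ Finset.range (Fintype.card ι), (x - i) := by
  revert ‹DecidableEq ι›
  refine Fintype.induction_empty_option (P := fun κ _ => ∀ [DecidableEq κ],
    ∑ σ : Perm κ, ((sign σ : ℤ) : ℚ) * x ^ σ.cycleCount =
      ∏ i ∈ Finset.range (Fintype.card κ), (x - i)) ?_ ?_ ?_ ι
  · intro κ μ _ e ih hd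
    let := Fintype.ofEquiv μ e.symm
    rw [← Fintype.card_congr e, ← ih, ← e.permCongr.sum_comp]
    refine Finset.sum_congr rfl fun σ _ => ?_
    rw [cycleCount, cycleCount, fullType_permCongr, Equiv.Perm.sign_permCongr]
  · intro hd
    simp [cycleCount, fullType]
  · intro κ _ ih hd
    obtain rfl : hd = Option.instDecidableEq := Subsingleton.elim _ _
    rw [sum_perm_option, Fintype.card_option, Finset.prod_range_succ, ← ih, Finset.sum_mul]
    refine Finset.sum_congr rfl fun σ _ => ?_
    simp [cycleCount_optionCongr, cycleCount_swap_some_mul_optionCongr]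
    ring

/-- The eigenvalue of `∑ τ, x ^ κ(τ) τ` on alternating functions of `k` of the `N` points,
as a product over the contents of a hook. -/
def hookContent (x : ℚ) (N k : ℕ) : ℚ := ∏ i ∈ Finset.range N, (x - k + 1 + i)

theorem sum_swap_none_comp {J ι : Type*} [Fintype J] [DecidableEq J] [Fintype ι] [DecidableEq ι]
    (G : (J → Option ι) → ℚ)
    (hG : ∀ (p : J → Option ι) w, ∑ j, G (Function.update p j w) = G p)
    (q : J → ι) (hq : q.Injective) :
    ∑ b, G (swap none (some b) ∘ some ∘ q) =
      (Fintype.card ι - Fintype.card J + 1) * G (some ∘ q) := by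
  rw [← Finset.sum_compl_add_sum (Finset.univ.image q), Finset.sum_image (fun a _ b _ h => hq h)]
  have h1 : ∀ j, swap none (some (q j)) ∘ some ∘ q = Function.update (some ∘ q) j none := by
    intro j
    ext1 l
    by_cases hl : l = j
    · subst hl; simp
    · rw [Function.update_of_ne hl]
      exact swap_apply_of_ne_of_ne (by simp) (by simpa using fun h => hl (hq h))
  have h2 : ∀ b ∈ (Finset.univ.image q)ᶜ, G (swap none (some b) ∘ some ∘ q) = G (some ∘ q) := by
    intro b hb
    congr 1
    ext1 l
    refine swap_apply_of_ne_of_ne (by simp) ?_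
    simp only [Finset.mem_compl, Finset.mem_image, Finset.mem_univ, true_and, not_exists] at hb
    simpa using hb l
  rw [Finset.sum_congr rfl h2, Finset.sum_const, Finset.card_compl,
    Finset.card_image_of_injective _ hq, Finset.card_univ, nsmul_eq_mul,
    Nat.cast_sub (Fintype.card_le_of_injective q hq)]
  simp only [h1, hG]
  ring

theorem sum_pow_cycleCount_mul_comp (x : ℚ) {J : Type*} [Fintype J] [DecidableEq J] (N : ℕ)
    {ι : Type u} [Fintype ι] [DecidableEq ι] (hN : Fintype.card ι = N) (F : (J → ι) → ℚ)
    (hF : ∀ (p : J → ι) w, ∑ j, F (Function.update p j w) = F p)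
    (hsign : ∀ (π : Perm J) (p : J → ι), F (p ∘ π) = (sign π : ℤ) * F p)
    (p : J → ι) (hp : p.Injective) :
    ∑ τ : Perm ι, x ^ τ.cycleCount * F (τ ∘ p) = hookContent x N (Fintype.card J) * F p := by
  induction N generalizing ι with
  | zero =>
    have : IsEmpty ι := Fintype.card_eq_zero_iff.1 hN
    have : IsEmpty J := p.isEmpty
    simp [hookContent, cycleCount, fullType]
  | succ N ih =>
    by_cases hs : p.Surjective
    · set e := Equiv.ofBijective p ⟨hp, hs⟩ with he
      have hcard : Fintype.card J = N + 1 := by rw [← hN, Fintype.card_congr e]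
      have h1 : ∀ τ : Perm ι, F (τ ∘ p) = (sign τ : ℤ) * F p := by
        intro τ
        rw [← sign_permCongr e.symm τ, ← hsign]
        congr 1
        ext j
        simp only [Function.comp_apply, permCongr_apply, symm_symm]
        exact (e.apply_symm_apply (τ (e j))).symm
      simp only [h1]
      have h2 := sum_sign_mul_pow_cycleCount x ι
      rw [hookContent, hcard, ← Finset.prod_range_reflect]
      rw [hN] at h2
      have h3 : ∏ i ∈ Finset.range (N + 1), (x - (N + 1 : ℕ) + 1 + (N + 1 - 1 - i : ℕ)) =
          ∏ i ∈ Finset.range (N + 1), (x - i) := by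
        refine Finset.prod_congr rfl fun i hi => ?_
        rw [Nat.add_sub_cancel, Nat.cast_sub (by simpa [Nat.lt_succ_iff] using hi)]
        push_cast
        ring
      rw [h3, ← h2, Finset.sum_mul]
      exact Finset.sum_congr rfl fun σ _ => by ring
    · obtain ⟨i, hi⟩ := not_forall.1 hs
      let e := optionSubtypeNe i
      have hcard : Fintype.card {j // j ≠ i} = N := by
        have := Fintype.card_congr e
        rw [Fintype.card_option] at this
        omega
      let q : J → {j // j ≠ i} := fun j => ⟨p j, fun h => hi ⟨j, h⟩⟩
      have hq : q.Injective := fun a b h => hp (congrArg Subtype.val h)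
      have hpq : p = e ∘ some ∘ q := by ext j; simp [e, q]
      have hG : ∀ (r : J → Option {j // j ≠ i}) w,
          ∑ j, F (e ∘ Function.update r j w) = F (e ∘ r) := by
        intro r w
        simp only [Function.comp_update, hF]
      have hH : ∀ (r : J → {j // j ≠ i}) w,
          ∑ j, F (e ∘ some ∘ Function.update r j w) = F (e ∘ some ∘ r) := by
        intro r w
        simp only [Function.comp_update, hF]
      have key := ih hcard (fun r => F (e ∘ some ∘ r)) hH (fun π r => hsign π (e ∘ some ∘ r)) q hq
      rw [hpq, hookContent, Finset.prod_range_succ, mul_right_comm, ← hookContent, ← key,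
        ← e.permCongr.sum_comp, sum_perm_option, Finset.sum_mul]
      refine Finset.sum_congr rfl fun σ _ => ?_
      have h1 : ∀ τ : Perm (Option {j // j ≠ i}),
          F (e.permCongr τ ∘ e ∘ some ∘ q) = F (e ∘ τ ∘ some ∘ q) := by
        intro τ; congr 1; ext j; simp
      have h2 := sum_swap_none_comp (fun r => F (e ∘ r)) hG (σ ∘ q) (σ.injective.comp hq)
      have h3 : optionCongr σ ∘ some ∘ q = some ∘ σ ∘ q := by ext j; simp
      have h4 : ∀ τ : Perm (Option {j // j ≠ i}),
          cycleCount (e.permCongr τ) = cycleCount τ := fun τ => by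
        rw [cycleCount, fullType_permCongr, cycleCount]
      simp only [h1, h4, cycleCount_optionCongr, cycleCount_swap_some_mul_optionCongr, coe_mul,
        Function.comp_assoc, h3, ← Finset.mul_sum]
      rw [h2, hcard]
      ring

end

section
open Equiv Equiv.Perm Matrix

variable {ι : Type*} [Fintype ι] [DecidableEq ι]

theorem Equiv.Perm.IsCycle.eq_one_or_eq {c : Perm ι} (hc : c.IsCycle) (π : Perm ι)
    (h : ∀ i, π i = i ∨ π i = c i) : π = 1 ∨ π = c := by
  by_contra! hne
  obtain ⟨x, hx⟩ : ∃ x, π x ≠ x := by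
    by_contra! h1
    exact hne.1 (Equiv.ext h1)
  refine hne.2 (Equiv.ext fun y => ?_)
  have step : ∀ z, π z ≠ z → π (c z) ≠ c z := by
    intro z hz h1
    have h2 : π z = c z := (h z).resolve_left hz
    exact hz (π.injective (by rw [h2, h1]))
  have hpow : ∀ k : ℕ, π ((c ^ k) x) ≠ (c ^ k) x := by
    intro k
    induction k with
    | zero => simpa using hx
    | succ k ih => rw [pow_succ']; exact step _ ih
  by_cases hy : c y = y
  · rcases h y with h1 | h1
    · rw [h1, hy]
    · exact h1
  · have hcx : c x ≠ x := fun h1 => (h x).elim hx (fun h2 => hx (h2.trans h1))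
    obtain ⟨k, hk⟩ := hc.exists_pow_eq hcx hy
    have := hpow k
    rw [hk] at this
    exact (h y).resolve_left this

theorem permMatrix_entry {κ : Type*} [DecidableEq κ] (R : Type*) [Zero R] [One R] (σ : Perm κ)
    (i j : κ) :
    σ.permMatrix R i j = if σ i = j then 1 else 0 := by
  simp [Equiv.Perm.permMatrix, PEquiv.toMatrix_apply, Equiv.toPEquiv_apply]

theorem charmatrix_permMatrix_apply (σ : Perm ι) (i j : ι) :
    (σ.permMatrix ℚ).charmatrix i j = (if i = j then X else 0) - if σ i = j then 1 else 0 := by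
  rw [charmatrix_apply, Matrix.diagonal_apply, permMatrix_entry]
  congr 1
  split_ifs <;> simp

theorem Equiv.Perm.IsCycle.charpoly_permMatrix {c : Perm ι} (hc : c.IsCycle) :
    (c.permMatrix ℚ).charpoly =
      (X - 1) ^ (Fintype.card ι - c.support.card) * (X ^ c.support.card - 1) := by
  rw [charpoly, ← det_transpose, det_apply]
  have hprod : ∀ f : ι → ℚ[X], ∏ i, f i = (∏ i ∈ c.supportᶜ, f i) * ∏ i ∈ c.support, f i :=
    fun f => (Finset.prod_compl_mul_prod c.support f).symm
  have hcompl : ∀ π : Perm ι, (∀ i, c i = i → π i = i) →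
      ∏ i ∈ c.supportᶜ, (c.permMatrix ℚ).charmatrixᵀ (π i) i =
        (X - 1) ^ (Fintype.card ι - c.support.card) := by
    intro π hπ
    rw [← Finset.card_compl, ← Finset.prod_const]
    refine Finset.prod_congr rfl fun i hi => ?_
    have hi : c i = i := by simpa using hi
    rw [transpose_apply, charmatrix_permMatrix_apply, hπ i hi]
    simp [hi]
  rw [Finset.sum_eq_add (1 : Perm ι) c hc.ne_one.symm]
  · rw [hprod, hprod, hcompl 1 (by simp), hcompl c (by simp), hc.sign,
      Finset.prod_congr (s₁ := c.support) (f := fun i => _ᵀ ((1 : Perm ι) i) i) rfl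
        (g := fun _ => (X : ℚ[X])),
      Finset.prod_congr (s₁ := c.support) (f := fun i => _ᵀ (c i) i) rfl
        (g := fun _ => (-1 : ℚ[X]))]
    · rcases Nat.even_or_odd c.support.card with h | h
      · simp [h.neg_one_pow]
        ring
      · simp [h.neg_one_pow]
        ring
    · intro i hi
      have hi : c i ≠ i := by simpa using hi
      rw [transpose_apply, charmatrix_permMatrix_apply]
      simp [hi.symm]
    · intro i hi
      have hi : c i ≠ i := by simpa using hi
      rw [transpose_apply, charmatrix_permMatrix_apply]
      simp [hi]
  · intro π _ hπ
    have : ∃ i, ¬ (π i = i ∨ π i = c i) := by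
      by_contra! h
      rcases hc.eq_one_or_eq π h with h | h
      · exact hπ.1 h
      · exact hπ.2 h
    obtain ⟨i, hi⟩ := this
    push Not at hi
    rw [Finset.prod_eq_zero (Finset.mem_univ i), smul_zero]
    rw [transpose_apply, charmatrix_permMatrix_apply]
    simp [hi.1.symm, hi.2.symm]
  · simp
  · simp

theorem Equiv.Perm.Disjoint.charpoly_permMatrix_mul {σ τ : Perm ι} (h : Disjoint σ τ) :
    ((σ * τ).permMatrix ℚ).charpoly * (X - 1) ^ Fintype.card ι =
      (σ.permMatrix ℚ).charpoly * (τ.permMatrix ℚ).charpoly := by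
  have hsum : σ.permMatrix ℚ + τ.permMatrix ℚ = 1 + (σ * τ).permMatrix ℚ := by
    ext i j
    simp only [Matrix.add_apply, permMatrix_entry, Matrix.one_apply]
    rcases h i with hi | hi
    · have hστ : (σ * τ) i = τ i := by
        rcases h (τ i) with h1 | h1
        · exact h1
        · rw [coe_mul, Function.comp_apply, τ.injective h1, hi]
      simp only [hi, hστ]
    · have hστ : (σ * τ) i = σ i := by rw [coe_mul, Function.comp_apply, hi]
      simp only [hi, hστ, add_comm]
  have hM : (τ.permMatrix ℚ).charmatrix * (σ.permMatrix ℚ).charmatrix =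
      (X - 1 : ℚ[X]) • ((σ * τ).permMatrix ℚ).charmatrix := by
    have h1 : (C.mapMatrix (σ.permMatrix ℚ)) + C.mapMatrix (τ.permMatrix ℚ) =
        1 + C.mapMatrix ((σ * τ).permMatrix ℚ) := by
      rw [← map_add, hsum, map_add, map_one]
    have h2 : C.mapMatrix (τ.permMatrix ℚ) * (C.mapMatrix (σ.permMatrix ℚ)) =
        C.mapMatrix ((σ * τ).permMatrix ℚ) := by
      rw [← map_mul, ← permMatrix_mul]
    simp only [charmatrix]
    have h3 := congrArg (fun M => (X : ℚ[X]) • M) h1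
    simp only [smul_add] at h3
    rw [scalar_apply, ← smul_one_eq_diagonal]
    simp only [sub_mul, mul_sub, smul_mul_assoc, mul_smul_comm, mul_one, one_mul, h2, smul_sub,
      sub_smul, one_smul]
    linear_combination (norm := module) -h3
  have hdet := congrArg det hM
  rw [det_mul, det_smul] at hdet
  rw [charpoly, charpoly, charpoly]
  linear_combination -hdet

theorem Equiv.Perm.charpoly_permMatrix (σ : Perm ι) :
    (σ.permMatrix ℚ).charpoly = (σ.fullType.map fun l => X ^ l - 1).prod := by
  have h1 : (X - 1 : ℚ[X]) ≠ 0 := X_sub_C_ne_zero 1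
  suffices h : (σ.permMatrix ℚ).charpoly * (X - 1) ^ σ.cycleType.sum =
      (X - 1) ^ Fintype.card ι * (σ.cycleType.map fun l => X ^ l - 1).prod by
    apply mul_right_cancel₀ (pow_ne_zero σ.cycleType.sum h1)
    rw [h, fullType]
    have hle := σ.sum_cycleType_le
    simp only [Multiset.map_add, Multiset.prod_add, Multiset.map_replicate, pow_one,
      Multiset.prod_replicate]
    rw [mul_assoc, ← pow_add, Nat.sub_add_cancel hle, mul_comm]
  induction σ using cycle_induction_on with
  | base_one =>
    simp only [permMatrix_one, charpoly_one]
    simp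
  | base_cycles σ hσ =>
    have hle := Finset.card_le_univ σ.support
    rw [hσ.charpoly_permMatrix, hσ.cycleType]
    simp only [Multiset.sum_singleton, Multiset.map_singleton, Multiset.prod_singleton]
    rw [mul_right_comm, ← pow_add, Nat.sub_add_cancel hle]
  | induction_disjoint σ τ hd _ hσ hτ =>
    apply mul_right_cancel₀ (pow_ne_zero (Fintype.card ι) h1)
    rw [hd.cycleType_mul, Multiset.sum_add, Multiset.map_add, Multiset.prod_add, mul_right_comm,
      hd.charpoly_permMatrix_mul, pow_add]
    linear_combination (τ.permMatrix ℚ).charpoly * (X - 1) ^ τ.cycleType.sum * hσ +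
      (X - 1) ^ Fintype.card ι * (σ.cycleType.map fun l => X ^ l - 1).prod * hτ

/-- The linear functional `X ^ k ↦ hookContent x N k`. -/
noncomputable def hookEval (x : ℚ) (N : ℕ) : ℚ[X] →ₗ[ℚ] ℚ :=
  Polynomial.lsum fun k => hookContent x N k • LinearMap.id

theorem hookEval_monomial (x : ℚ) (N k : ℕ) (a : ℚ) :
    hookEval x N (monomial k a) = hookContent x N k * a := by
  simp [hookEval, lsum_apply]

theorem hookEval_X_pow (x : ℚ) (N k : ℕ) : hookEval x N (X ^ k) = hookContent x N k := by
  rw [X_pow_eq_monomial, hookEval_monomial, mul_one]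

/-- The matrix `A` with the rows in `s` replaced by standard basis vectors. -/
def Matrix.replaceRows (A : Matrix ι ι ℚ) (s : Finset ι) (p : s → ι) : Matrix ι ι ℚ :=
  Matrix.of fun i => if h : i ∈ s then Pi.single (p ⟨i, h⟩) 1 else A i

theorem Matrix.sum_det_replaceRows_update (A : Matrix ι ι ℚ) (hA : A *ᵥ 1 = 0) (s : Finset ι)
    (p : s → ι) (w : ι) :
    ∑ j, (A.replaceRows s (Function.update p j w)).det = (A.replaceRows s p).det := by
  set M := A.replaceRows s p with hM
  have hrow : ∀ j : s, A.replaceRows s (Function.update p j w) = M.updateRow j (Pi.single w 1) := by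
    intro j
    ext1 i
    by_cases hij : i = j
    · subst hij
      simp [replaceRows]
    · rw [updateRow_ne hij]
      by_cases hi : i ∈ s
      · have : (⟨i, hi⟩ : s) ≠ j := fun h => hij (congrArg Subtype.val h)
        simp [hM, replaceRows, hi, Function.update_of_ne this]
      · simp [hM, replaceRows, hi]
  have hone : M *ᵥ 1 = fun i => if i ∈ s then 1 else 0 := by
    ext i
    by_cases hi : i ∈ s
    · simp [hM, replaceRows, mulVec, hi]
    · have := congrFun hA i
      simp [mulVec] at this
      simp [hM, replaceRows, mulVec, hi, this]
  have h := congrArg (fun v => v ⬝ᵥ (1 : ι → ℚ)) (mulVec_cramer Mᵀ (Pi.single w 1))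
  simp only [mulVec_transpose, ← dotProduct_mulVec, hone, det_transpose, smul_dotProduct] at h
  simp only [hrow, ← cramer_transpose_apply]
  rw [dotProduct] at h
  simp only [mul_ite, mul_one, mul_zero, Finset.sum_ite_mem, Finset.univ_inter] at h
  rw [← Finset.sum_coe_sort] at h
  simpa using h

theorem Matrix.det_replaceRows_comp (A : Matrix ι ι ℚ) (s : Finset ι) (π : Perm s) (p : s → ι) :
    (A.replaceRows s (p ∘ π)).det = (sign π : ℤ) * (A.replaceRows s p).det := by
  have : A.replaceRows s (p ∘ π) = (A.replaceRows s p).submatrix (ofSubtype π) id := by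
    ext i j
    by_cases hi : i ∈ s
    · have h : (ofSubtype π i) = π ⟨i, hi⟩ := ofSubtype_apply_of_mem π hi
      simp [replaceRows, hi, h]
    · have h : (ofSubtype π i) = i := ofSubtype_apply_of_not_mem π hi
      simp [replaceRows, hi, h]
  rw [this, det_permute, sign_ofSubtype]

theorem sum_pow_cycleCount_mul_det (x : ℚ) (A : Matrix ι ι ℚ) (hA : A *ᵥ 1 = 0) :
    ∑ τ : Perm ι, x ^ τ.cycleCount * (τ.permMatrix ℚ + A).det =
      hookEval x (Fintype.card ι) (-A).charpoly := by
  have h1 : ∀ τ : Perm ι, (τ.permMatrix ℚ + A).det =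
      ∑ s : Finset ι, (A.replaceRows s (τ ∘ Subtype.val)).det := by
    intro τ
    refine ((detRowAlternating (R := ℚ) (n := ι)).map_add_univ (τ.permMatrix ℚ) A).trans ?_
    refine Finset.sum_congr rfl fun s _ => ?_
    refine congrArg det ?_
    ext i j
    by_cases hi : i ∈ s
    · have h : s.piecewise (τ.permMatrix ℚ) A i = τ.permMatrix ℚ i :=
        Finset.piecewise_eq_of_mem _ _ _ hi
      refine (congrFun h j).trans ?_
      simp [replaceRows, hi, Pi.single_apply, eq_comm]
    · have h : s.piecewise (τ.permMatrix ℚ) A i = A i :=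
        Finset.piecewise_eq_of_notMem _ _ _ hi
      refine (congrFun h j).trans ?_
      simp [replaceRows, hi]
  have h2 : (-A).charpoly =
      ∑ s : Finset ι, monomial s.card (A.replaceRows s Subtype.val).det := by
    have h3 : (-A).charmatrix = (X : ℚ[X]) • (1 : Matrix ι ι ℚ[X]) + A.map C := by
      ext1 i j
      simp [charmatrix_apply, Matrix.one_apply, Matrix.diagonal_apply]
    rw [charpoly, h3]
    refine ((detRowAlternating (R := ℚ[X]) (n := ι)).map_add_univ _ (A.map C)).trans ?_
    refine Finset.sum_congr rfl fun s _ => ?_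
    set B : ι → ι → ℚ[X] := (A.replaceRows s Subtype.val).map C with hB
    have h4 : s.piecewise ((X : ℚ[X]) • (1 : Matrix ι ι ℚ[X])) (A.map C) =
        s.piecewise (fun i => (X : ℚ[X]) • B i) B := by
      ext1 i
      by_cases hi : i ∈ s
      · rw [Finset.piecewise_eq_of_mem _ _ _ hi]
        refine (Finset.piecewise_eq_of_mem _ _ _ hi).trans ?_
        ext1 j
        change (X : ℚ[X]) * (1 : Matrix ι ι ℚ[X]) i j = X * C (A.replaceRows s Subtype.val i j)
        simp [replaceRows, hi, Matrix.one_apply, Pi.single_apply, eq_comm]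
      · rw [Finset.piecewise_eq_of_notMem _ _ _ hi]
        refine (Finset.piecewise_eq_of_notMem _ _ _ hi).trans ?_
        ext1 j
        simp [hB, replaceRows, hi]
    rw [h4]
    refine ((detRowAlternating (R := ℚ[X]) (n := ι)).toMultilinearMap.map_piecewise_smul
      (fun _ => X) _ s).trans ?_
    rw [Finset.prod_const, ← C_mul_X_pow_eq_monomial, smul_eq_mul, mul_comm]
    congr 1
    exact (RingHom.map_det C _).symm
  rw [h2, map_sum]
  simp only [h1, Finset.mul_sum]
  rw [Finset.sum_comm]
  refine Finset.sum_congr rfl fun s _ => ?_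
  rw [hookEval_monomial]
  have := sum_pow_cycleCount_mul_comp x (Fintype.card ι) rfl
    (fun p : s → ι => (A.replaceRows s p).det) (A.sum_det_replaceRows_update hA s)
    (A.det_replaceRows_comp s) Subtype.val Subtype.val_injective
  rwa [Fintype.card_coe] at this

/-- The rank-one projection onto constant vectors. -/
def averageMatrix (ι : Type*) [Fintype ι] : Matrix ι ι ℚ :=
  Matrix.of fun _ _ => (Fintype.card ι : ℚ)⁻¹

theorem X_mul_charpoly_smul_averageMatrix [Nonempty ι] (c : ℚ) :
    X * (c • averageMatrix ι).charpoly = X ^ Fintype.card ι * (X - C c) := by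
  have hN : (Fintype.card ι : ℚ) ≠ 0 := by simp
  have h := charpoly_mul_comm' (replicateCol Unit fun _ : ι => c)
    (replicateRow Unit fun _ : ι => (Fintype.card ι : ℚ)⁻¹)
  have h1 : replicateCol Unit (fun _ : ι => c) *
      replicateRow Unit (fun _ : ι => (Fintype.card ι : ℚ)⁻¹) = c • averageMatrix ι := by
    ext i j
    simp [averageMatrix, Matrix.mul_apply]
  have h2 : (replicateRow Unit (fun _ : ι => (Fintype.card ι : ℚ)⁻¹) *
      replicateCol Unit (fun _ : ι => c)).charpoly = X - C c := by
    rw [charpoly, det_unique, charmatrix_apply]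
    simp [Matrix.mul_apply, hN]
  rw [h1, h2] at h
  simpa using h

theorem averageMatrix_mul_permMatrix (σ : Perm ι) :
    averageMatrix ι * σ.permMatrix ℚ = averageMatrix ι := by
  ext i j
  simp [averageMatrix, Matrix.mul_apply, ← Equiv.eq_symm_apply]

theorem permMatrix_mul_averageMatrix (σ : Perm ι) :
    σ.permMatrix ℚ * averageMatrix ι = averageMatrix ι := by
  ext i j
  simp [averageMatrix, Matrix.mul_apply]

theorem charpoly_permMatrix_add_smul_averageMatrix [Nonempty ι] (σ : Perm ι) (c : ℚ) :
    (X - 1) * (σ.permMatrix ℚ + c • averageMatrix ι).charpoly =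
      (X - 1 - C c) * (σ.permMatrix ℚ).charpoly := by
  have h1 : (X - 1 : ℚ[X]) ≠ 0 := X_sub_C_ne_zero 1
  have hE : (X - 1) * (c • averageMatrix ι + scalar ι (1 : ℚ)).charpoly =
      (X - 1) ^ Fintype.card ι * (X - 1 - C c) := by
    have h := congrArg (fun p : ℚ[X] => p.comp (X + C (-1)))
      (X_mul_charpoly_smul_averageMatrix (ι := ι) c)
    have h2 := charpoly_sub_scalar (c • averageMatrix ι) (-1)
    rw [map_neg, sub_neg_eq_add] at h2
    simp only [mul_comp, X_comp, pow_comp, sub_comp, C_comp, ← h2] at h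
    simpa [sub_eq_add_neg, add_right_comm] using h
  have hM : (σ.permMatrix ℚ).charmatrix * (c • averageMatrix ι + scalar ι (1 : ℚ)).charmatrix =
      (X - 1 : ℚ[X]) • (σ.permMatrix ℚ + c • averageMatrix ι).charmatrix := by
    have h2 : C.mapMatrix (σ.permMatrix ℚ) * C.mapMatrix (c • averageMatrix ι) =
        C.mapMatrix (c • averageMatrix ι) := by
      rw [← map_mul, mul_smul_comm, permMatrix_mul_averageMatrix]
    simp only [charmatrix, map_add, map_one]
    rw [scalar_apply, ← smul_one_eq_diagonal]
    simp only [sub_mul, mul_sub, mul_add, smul_mul_assoc, mul_smul_comm, mul_one, one_mul, h2,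
      smul_sub, sub_smul, one_smul, smul_add]
    module
  have hdet := congrArg det hM
  rw [det_mul, det_smul] at hdet
  rw [← charpoly, ← charpoly, ← charpoly] at hdet
  apply mul_left_cancel₀ (pow_ne_zero (Fintype.card ι) h1)
  linear_combination (-(X - 1)) * hdet + (σ.permMatrix ℚ).charpoly * hE

theorem det_permMatrix_sub_one_add_averageMatrix [Nonempty ι] (ω : Perm ι) :
    (ω.permMatrix ℚ - 1 + averageMatrix ι).det =
      if ω.fullType = {Fintype.card ι} then (-1) ^ (Fintype.card ι + 1) * (Fintype.card ι : ℚ)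
      else 0 := by
  have h1 : (X - 1 : ℚ[X]) ≠ 0 := X_sub_C_ne_zero 1
  have hχ := charpoly_permMatrix_add_smul_averageMatrix ω 1
  have hdet : (ω.permMatrix ℚ - 1 + averageMatrix ι).det =
      (-1) ^ Fintype.card ι * (ω.permMatrix ℚ + (1 : ℚ) • averageMatrix ι).charpoly.eval 1 := by
    rw [eval_charpoly, ← det_neg, map_one, one_smul]
    congr 1
    abel
  rw [charpoly_permMatrix] at hχ
  rw [hdet]
  have hsum := ω.sum_fullType
  have hdvd : ∀ l : ℕ, (X : ℚ[X]) ^ l - 1 = (X - 1) * ∑ i ∈ Finset.range l, X ^ i :=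
    fun l => (mul_geom_sum X l).symm
  split_ifs with h
  · rw [h, Multiset.map_singleton, Multiset.prod_singleton, hdvd, mul_left_comm] at hχ
    rw [mul_left_cancel₀ h1 hχ]
    simp [eval_finsetSum]
    ring
  · obtain ⟨a, ha⟩ := Multiset.exists_mem_of_ne_zero (s := ω.fullType) fun h0 => by
      rw [h0, Multiset.sum_zero] at hsum
      exact Fintype.card_ne_zero hsum.symm
    obtain ⟨r, hr⟩ := Multiset.exists_cons_of_mem ha
    obtain ⟨b, hb⟩ := Multiset.exists_mem_of_ne_zero (s := r) fun h0 => by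
      subst h0
      rw [hr, Multiset.sum_cons, Multiset.sum_zero, add_zero] at hsum
      exact h (by rw [hr, hsum]; rfl)
    obtain ⟨s, rfl⟩ := Multiset.exists_cons_of_mem hb
    simp only [hr, Multiset.map_cons, Multiset.prod_cons] at hχ
    rw [hdvd a, mul_assoc (X - 1), mul_left_comm] at hχ
    rw [mul_left_cancel₀ h1 hχ]
    simp

theorem sum_pow_cycleCount_mul_fullCycle [Nonempty ι] (x : ℚ) (α : Perm ι) (q : ℚ[X])
    (hq : (X - 1) * q = X * (α.permMatrix ℚ).charpoly) :
    (-1) ^ (Fintype.card ι + 1) * (Fintype.card ι : ℚ) * (sign α : ℤ) *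
      ∑ ω : Perm ι with ω.fullType = {Fintype.card ι}, x ^ (α * ω).cycleCount =
      hookEval x (Fintype.card ι) q := by
  set A := averageMatrix ι - α.permMatrix ℚ with hA
  have hA1 : A *ᵥ 1 = 0 := by
    ext i
    simp [hA, averageMatrix, mulVec, dotProduct]
  have hq' : (-A).charpoly = q := by
    apply mul_left_cancel₀ (X_sub_C_ne_zero (1 : ℚ))
    have h := charpoly_permMatrix_add_smul_averageMatrix α (-1)
    have h2 : -A = α.permMatrix ℚ + (-1 : ℚ) • averageMatrix ι := by
      rw [hA, neg_one_smul]; abel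
    rw [C_1, hq, h2, h]
    simp
  rw [← hq', ← sum_pow_cycleCount_mul_det x A hA1]
  refine Eq.trans ?_
    (_root_.Equiv.sum_comp (Equiv.mulLeft α) fun τ : Perm ι =>
      x ^ τ.cycleCount * (τ.permMatrix ℚ + A).det)
  rw [Finset.sum_filter, Finset.mul_sum]
  refine Finset.sum_congr rfl fun ω _ => ?_
  have hfac : (α * ω).permMatrix ℚ + A =
      (ω.permMatrix ℚ - 1 + averageMatrix ι) * α.permMatrix ℚ := by
    rw [permMatrix_mul, add_mul, sub_mul, one_mul, averageMatrix_mul_permMatrix, hA]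
    abel
  rw [coe_mulLeft, hfac, det_mul, det_permutation, det_permMatrix_sub_one_add_averageMatrix]
  split_ifs <;> ring

theorem sum_pow_cycleCount_mul_fix_none {κ : Type*} [Fintype κ] [DecidableEq κ] (x : ℚ)
    (α : Perm (Option κ)) (hα : α none ≠ none) (β : Multiset ℕ) :
    ∑ ω : Perm (Option κ) with ω.fullType = 1 ::ₘ β ∧ ω none = none, x ^ (α * ω).cycleCount =
      ∑ ω : Perm κ with ω.fullType = β, x ^ cycleCount (removeNone α * ω) := by
  rw [Finset.sum_filter, Finset.sum_filter, sum_perm_option]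
  refine Finset.sum_congr rfl fun σ _ => ?_
  have h : (α * optionCongr σ).cycleCount = cycleCount (removeNone α * σ) := by
    have h1 := cycleCount_swap_mul (α * optionCongr σ) none (by simpa using hα)
    have h2 : swap none ((α * optionCongr σ) none) * (α * optionCongr σ) =
        optionCongr (removeNone α * σ) := by
      have h3 : optionCongr (removeNone α * σ) = optionCongr (removeNone α) * optionCongr σ :=
        (optionCongr_trans σ (removeNone α))
      rw [← mul_assoc, h3, map_equiv_removeNone]
      simp
    rw [h2, cycleCount_optionCongr] at h1
    omega
  simp [fullType_optionCongr, h]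

theorem sum_pow_cycleCount_mul_fix_point (x : ℚ) (α : Perm ι) (i : ι) (hi : α i ≠ i) (N : ℕ)
    (hN : Fintype.card ι = N + 1) (q : ℚ[X])
    (hq : (X - 1) * q = X * ((X ^ ((α.cycleOf i).support.card - 1) - 1) *
      ((α.fullType.erase (α.cycleOf i).support.card).map fun l => X ^ l - 1).prod)) :
    (-1) ^ N * (N : ℚ) * (sign α : ℤ) *
      ∑ ω : Perm ι with ω.fullType = {1, N} ∧ ω i = i, x ^ (α * ω).cycleCount =
      hookEval x N q := by
  set e := optionSubtypeNe i with he
  set a := e.symm.permCongr α with ha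
  have he0 : e none = i := rfl
  have hei : e.symm i = none := by rw [symm_apply_eq, he0]
  have ha0 : a none = e.symm (α i) := by simp [ha, he0]
  have hane : a none ≠ none := by
    rw [ha0, ne_eq, symm_apply_eq, he0]
    exact hi
  have hea : e.permCongr a = α := by
    ext j
    simp [ha]
  have hcardκ : Fintype.card {j // j ≠ i} = N := by
    have := Fintype.card_congr e
    rw [Fintype.card_option, hN] at this
    omega
  have : Nonempty {j // j ≠ i} := ⟨⟨α i, hi⟩⟩
  have hrem : e.permCongr (optionCongr (removeNone a)) = swap i (α i) * α := by
    rw [map_equiv_removeNone, ← hea]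
    ext j
    simp [permCongr_apply, hei, e.injective.map_swap, he0]
  obtain ⟨r, hr1, hr2⟩ := exists_fullType_swap_mul α i hi
  rw [← hrem, fullType_permCongr, fullType_optionCongr, Multiset.cons_inj_right] at hr2
  have hsign : sign (removeNone a) = - sign α := by
    rw [← optionCongr_sign, ← sign_permCongr e, hrem, Perm.sign_mul, sign_swap (Ne.symm hi)]
    simp
  have hmain := sum_pow_cycleCount_mul_fullCycle x (removeNone a) q (by
    rw [hq, charpoly_permMatrix, hr2, hr1, Multiset.erase_cons_head, Multiset.map_cons,
      Multiset.prod_cons])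
  rw [hcardκ, ← sum_pow_cycleCount_mul_fix_none x a hane, hsign] at hmain
  rw [← hmain, Finset.sum_filter, Finset.sum_filter, ← _root_.Equiv.sum_comp e.permCongr]
  have hfix : ∀ ω : Perm (Option {j // j ≠ i}), e.permCongr ω i = i ↔ ω none = none := by
    intro ω
    rw [permCongr_apply, hei, ← eq_symm_apply, hei]
  have hcount : ∀ ω : Perm (Option {j // j ≠ i}),
      (α * e.permCongr ω).cycleCount = (a * ω).cycleCount := by
    intro ω
    rw [← hea, ← permCongr_mul, cycleCount, cycleCount, fullType_permCongr]
  simp only [fullType_permCongr, hfix, hcount]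
  push_cast
  ring_nf
  rfl

theorem card_fixed_of_fullType {ω : Perm ι} {N : ℕ} (hN : N ≠ 1) (hω : ω.fullType = {1, N}) :
    (Finset.univ.filter fun i => ω i = i).card = 1 := by
  have h1 : ω.fullType.count 1 = Fintype.card ι - ω.cycleType.sum := by
    have : ω.cycleType.count 1 = 0 :=
      Multiset.count_eq_zero.2 fun h => by simpa using two_le_of_mem_cycleType h
    rw [fullType, Multiset.count_add, this, Multiset.count_replicate_self, zero_add]
  have h2 : (Finset.univ.filter fun i => ω i = i) = ω.supportᶜ := by
    ext i
    simp
  rw [h2, Finset.card_compl, ← sum_cycleType, ← h1, hω]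
  simp [hN.symm]

theorem cycleType_eq_fullType {α : Perm ι} (h : 1 ∉ α.fullType) : α.cycleType = α.fullType := by
  rw [fullType, Multiset.mem_add, Multiset.mem_replicate] at h
  have : Fintype.card ι - α.cycleType.sum = 0 := by tauto
  rw [fullType, this, Multiset.replicate_zero, add_zero]

theorem sum_pow_cycleCount_mul_near_cycle (x : ℚ) (N : ℕ) (hN : 5 ≤ N)
    (hcard : Fintype.card ι = N + 1) (α : Perm ι) (hα : α.fullType = {2, N - 1}) :
    -(N : ℚ) * ∑ ω : Perm ι with ω.fullType = {1, N}, x ^ (α * ω).cycleCount =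
      (N + 1) * hookContent x N N + (N - 1) * hookContent x N (N - 1)
        - (N - 1) * hookContent x N 2 - (N + 1) * hookContent x N 1 := by
  obtain ⟨m, rfl⟩ : ∃ m, N = m + 2 := ⟨N - 2, by omega⟩
  have hm1 : m + 2 - 1 = m + 1 := by omega
  rw [hm1] at hα ⊢
  have hct : α.cycleType = {2, m + 1} := by
    rw [cycleType_eq_fullType (by rw [hα]; simp; omega), hα]
  have hsupp : α.support = Finset.univ := by
    rw [← Finset.card_eq_iff_eq_univ, ← sum_cycleType, hct, hcard]
    simp; omega
  have hsign : (-1) ^ (m + 2) * ((m + 2 : ℕ) : ℚ) * (sign α : ℤ) = -((m + 2 : ℕ) : ℚ) := by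
    rw [sign_of_cycleType, hct]
    have : (-1 : ℚ) ^ m * (-1) ^ m = 1 := by rw [← mul_pow]; simp
    simp [pow_add]
    linear_combination (-(m : ℚ) - 2) * this
  have hfib : ∑ ω : Perm ι with ω.fullType = {1, m + 2}, x ^ (α * ω).cycleCount =
      ∑ i, ∑ ω : Perm ι with ω.fullType = {1, m + 2} ∧ ω i = i, x ^ (α * ω).cycleCount := by
    simp only [← Finset.filter_filter]
    simp only [Finset.sum_filter (p := fun ω : Perm ι => ω _ = _)]
    rw [Finset.sum_comm]
    refine Finset.sum_congr rfl fun ω hω => ?_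
    rw [← Finset.sum_filter, Finset.sum_const,
      card_fixed_of_fullType (by omega) (Finset.mem_filter.1 hω).2, one_smul]
  set q : ℕ → ℚ[X] := fun l => if l = 2 then X ^ (m + 2) - X else
    X ^ (m + 2) + X ^ (m + 1) - X ^ 2 - X with hqdef
  have hq : ∀ i, (X - 1) * q (α.cycleOf i).support.card =
      X * ((X ^ ((α.cycleOf i).support.card - 1) - 1) *
      ((α.fullType.erase (α.cycleOf i).support.card).map fun l => X ^ l - 1).prod) := by
    intro i
    have hi : α i ≠ i := by rw [← mem_support, hsupp]; simp
    obtain ⟨r, hr, -⟩ := exists_fullType_swap_mul α i hi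
    have hmem : (α.cycleOf i).support.card ∈ α.fullType := by rw [hr]; simp
    rw [hα] at hmem ⊢
    simp only [Multiset.insert_eq_cons, Multiset.mem_cons, Multiset.mem_singleton] at hmem
    rcases hmem with h | h
    · rw [h]
      simp [hqdef]
      ring
    · rw [h]
      have h2 : m + 1 ≠ 2 := by omega
      rw [Multiset.insert_eq_cons, Multiset.erase_cons_tail _ (by simpa using h2.symm)]
      simp [hqdef, h2]
      ring
  rw [hfib, ← hsign, Finset.mul_sum]
  have hpt : ∀ i ∈ Finset.univ, _ = _ := fun i _ => sum_pow_cycleCount_mul_fix_point x α i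
    (by rw [← mem_support, hsupp]; simp) (m + 2) hcard _ (hq i)
  rw [Finset.sum_congr rfl hpt, ← hsupp,
    sum_card_support_cycleOf α fun l => hookEval x (m + 2) (q l), hct]
  have h2 : m + 1 ≠ 2 := by omega
  have hX : hookEval x (m + 2) X = hookContent x (m + 2) 1 := by
    rw [← hookEval_X_pow, pow_one]
  simp [hqdef, h2, hookEval_X_pow, hX]
  ring

end

section
open Equiv Equiv.Perm

theorem fullCycleType_eq_fullType {n : ℕ} (σ : Perm (Fin n)) : fullCycleType σ = σ.fullType := by
  rw [fullCycleType, fullType, Fintype.card_fin]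

theorem numCycles_eq_cycleCount {n : ℕ} (σ : Perm (Fin n)) : numCycles σ = σ.cycleCount := by
  rw [numCycles, fullCycleType_eq_fullType, cycleCount]

theorem eval_binomPoly_natCast (x : ℚ) (c : ℤ) (N : ℕ) :
    (binomPoly c N).eval x = (N.factorial : ℚ)⁻¹ * (descPochhammer ℚ N).eval (x + c) := by
  simp [binomPoly]

theorem hookContent_eq_eval_descPochhammer (x : ℚ) (N k : ℕ) :
    hookContent x N k = (descPochhammer ℚ N).eval (x - k + N) := by
  rw [hookContent, descPochhammer_eval_eq_prod_range, ← Finset.prod_range_reflect]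
  refine Finset.prod_congr rfl fun i hi => ?_
  have : ((N - 1 - i : ℕ) : ℚ) = N - 1 - i := by
    have := Finset.mem_range.1 hi
    rw [Nat.sub_sub, Nat.cast_sub (by omega)]
    push_cast
    ring
  rw [this]
  ring

theorem eval_descPochhammer_add_one_mul (N : ℕ) (y : ℚ) :
    (descPochhammer ℚ N).eval (y + 1) * (y + 1 - N) = (y + 1) * (descPochhammer ℚ N).eval y := by
  simp only [descPochhammer_eval_eq_prod_range]
  rw [← Finset.prod_range_succ (fun i : ℕ => y + 1 - i), Finset.prod_range_succ', mul_comm]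
  congr 1
  · simp
  · refine Finset.prod_congr rfl fun i _ => ?_
    push_cast
    ring

end

/-- explicit formula for `P_{[2,n−2],[1,n−1]}(x)`, `n ≥ 6`. -/
theorem Pperm_beta_one_formula (n : ℕ) (hn : 6 ≤ n)
    (α : Equiv.Perm (Fin n)) (hα : fullCycleType α = ({2, n - 2} : Multiset ℕ)) :
    Pperm α ({1, n - 1} : Multiset ℕ) =
      ((n : ℚ) - 1) • (Polynomial.X *
        (binomPoly ((n : ℤ) - 1) ((n : ℤ) - 1) + binomPoly (-1) ((n : ℤ) - 1)
          - binomPoly 1 ((n : ℤ) - 1) - binomPoly ((n : ℤ) - 3) ((n : ℤ) - 1))) := by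
  obtain ⟨N, rfl⟩ : ∃ N, n = N + 1 := ⟨n - 1, by omega⟩
  obtain ⟨T, hT⟩ : ∃ T : ℚ → ℚ, ∀ y, (descPochhammer ℚ N).eval y = T y := ⟨_, fun _ => rfl⟩
  have hN5 : 5 ≤ N := by omega
  rw [fullCycleType_eq_fullType, show N + 1 - 2 = N - 1 by omega] at hα
  have hcast : ((N - 1 : ℕ) : ℚ) = N - 1 := by rw [Nat.cast_sub (by omega), Nat.cast_one]
  have hsum : ∀ x : ℚ, -(N : ℚ) * ∑ ω ∈ permClass (N + 1) {1, N}, x ^ numCycles (α * ω) =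
      (N + 1) * T x + (N - 1) * T (x + 1) - (N - 1) * T (x + N - 2)
        - (N + 1) * T (x + N - 1) := by
    intro x
    have h := sum_pow_cycleCount_mul_near_cycle x N hN5 (Fintype.card_fin _) α hα
    simp only [hookContent_eq_eval_descPochhammer, hT, hcast, Nat.cast_ofNat, Nat.cast_one] at h
    simp only [permClass, fullCycleType_eq_fullType, numCycles_eq_cycleCount]
    rw [h, show x - N + N = x by ring, show x - (N - 1) + N = x + 1 by ring,
      show x - 2 + N = x + N - 2 by ring, show x - 1 + N = x + N - 1 by ring]
  have hzero : ∀ k : ℕ, k < N → T k = 0 := by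
    intro k hk
    rw [← hT, descPochhammer_eval_eq_prod_range]
    exact Finset.prod_eq_zero (Finset.mem_range.2 hk) (sub_self _)
  have hfact : (N.factorial : ℚ) ≠ 0 := Nat.cast_ne_zero.2 N.factorial_ne_zero
  have hN0 : (N : ℚ) ≠ 0 := by
    rw [Nat.cast_ne_zero]
    omega
  have hcardmul : (N : ℚ) * (permClass (N + 1) {1, N}).card = (N + 1) * N.factorial := by
    have h := hsum 1
    have h1 := hzero 1 (by omega)
    have h2 := hzero 2 (by omega)
    have h3 := hzero (N - 1) (by omega)
    have h4 : T N = N.factorial := by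
      rw [← hT, descPochhammer_eval_eq_descFactorial, Nat.descFactorial_self]
    rw [hcast] at h3
    push_cast at h1 h2
    rw [show (1 : ℚ) + 1 = 2 by norm_num, show (1 : ℚ) + N - 2 = N - 1 by ring,
      show (1 : ℚ) + N - 1 = N by ring, h1, h2, h3, h4] at h
    simp only [one_pow, Finset.sum_const, nsmul_eq_mul, mul_one] at h
    linear_combination -h
  have hcard : ((permClass (N + 1) {1, N}).card : ℚ) ≠ 0 := by
    intro h0
    rw [h0, mul_zero] at hcardmul
    exact mul_ne_zero (Nat.cast_add_one_ne_zero N) hfact hcardmul.symm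
  refine Polynomial.funext fun x => ?_
  have e1 := eval_descPochhammer_add_one_mul N (x + N - 1)
  have e2 := eval_descPochhammer_add_one_mul N (x - 1)
  have e3 := eval_descPochhammer_add_one_mul N x
  have e4 := eval_descPochhammer_add_one_mul N (x + N - 2)
  rw [hT, hT, show x + N - 1 + 1 = x + N by ring] at e1
  rw [hT, hT, show x - 1 + 1 = x by ring] at e2
  rw [hT, hT] at e3
  rw [hT, hT, show x + N - 2 + 1 = x + N - 1 by ring] at e4
  have hsx := hsum x
  have hcastZ : ((N + 1 : ℕ) : ℤ) - 1 = N := by push_cast; ring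
  rw [hcastZ, Nat.add_sub_cancel]
  simp only [Pperm, eval_mul, eval_C, eval_finsetSum, eval_pow, eval_X, eval_smul, smul_eq_mul,
    eval_sub, eval_add, eval_binomPoly_natCast, hT]
  set S := ∑ ω ∈ permClass (N + 1) {1, N}, x ^ numCycles (α * ω)
  push_cast
  rw [show x + -1 = x - 1 by ring, show x + (N + 1 - 3 : ℚ) = x + N - 2 by ring]
  have hu := inv_mul_cancel₀ hfact
  have hR : x * (T (x + N) + T (x - 1) - T (x + 1) - T (x + N - 2)) = N * S := by
    linear_combination hsx + e1 - e2 - e3 + e4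
  rw [div_mul_eq_mul_div, div_eq_iff hcard]
  linear_combination -N * (N.factorial : ℚ)⁻¹ * (permClass (N + 1) {1, N}).card * hR
    - N * (N.factorial : ℚ)⁻¹ * S * hcardmul
    - N * (N + 1) * S * hu
end

section
/- Let n ≥ 6 and let β = (β_1,…,β_d) be a partition of n all of whose parts satisfy β_i ≥ 3. Define the polynomial G(x) = Σ_{S ⊆ {1,…,d}} (−1)^{d−|S|} binom(x−2+β_S, n−2). Then P_{[2,n−2],β}(x) = x(x−1) G(x) + (−1)^{n−d} x(x+1) G(−x). -/
open Polynomial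
open scoped Classical

section CycleWeights

open Equiv Equiv.Perm

variable {α : Type*} [DecidableEq α]

theorem disjoint_formPerm {l : List α} {ρ : Perm α} (hρ : ∀ x ∈ l, ρ x = x) :
    Disjoint l.formPerm ρ := by
  intro x
  by_cases hx : x ∈ l
  · exact Or.inr (hρ x hx)
  · exact Or.inl (List.formPerm_apply_of_notMem hx)

theorem sameCycle_formPerm {l : List α} (hl : l.Nodup) {x y : α} (hx : x ∈ l) (hy : y ∈ l) :
    SameCycle l.formPerm x y := by
  match l, hl, hx, hy with
  | [a], _, hx, hy =>
    rw [List.mem_singleton] at hx hy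
    rw [hx, hy]
  | a :: b :: l, hl, hx, hy =>
    have hc := List.isCycle_formPerm hl (by simp)
    have key : ∀ z ∈ a :: b :: l, (a :: b :: l).formPerm z ≠ z := fun z hz =>
      (List.formPerm_apply_mem_ne_self_iff _ hl z hz).2 (by simp)
    exact hc.sameCycle (key x hx) (key y hy)

theorem swap_mul_formPerm_append {v j : α} {l₁ l₂ : List α} (h : (v :: l₁ ++ j :: l₂).Nodup) :
    swap v j * (v :: l₁ ++ j :: l₂).formPerm = (v :: l₁).formPerm * (j :: l₂).formPerm := by
  have key : ∀ l : List α, (l ++ j :: l₂).formPerm = (l ++ [j]).formPerm * (j :: l₂).formPerm := by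
    intro l
    induction l with
    | nil => simp
    | cons x l ih =>
      cases l with
      | nil => simp
      | cons y l => simpa [mul_assoc] using ih
  have hn : (v :: l₁ ++ [j]).Nodup := h.sublist (by simp)
  have hrot : (v :: l₁ ++ [j]).formPerm = (j :: v :: l₁).formPerm :=
    List.formPerm_eq_of_isRotated hn (by
      simpa using (List.isRotated_append (l := v :: l₁) (l' := [j])))
  rw [key, hrot, List.formPerm_cons_cons, swap_comm j v, ← mul_assoc, ← mul_assoc,
    swap_mul_self, one_mul]

variable [Fintype α]

/-- The set of elements in the same cycle of `τ` as `x`. -/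
noncomputable def cycleFinset (τ : Perm α) (x : α) : Finset α :=
  Finset.univ.filter (τ.SameCycle x)

/-- The set of cycles of `τ` (fixed points included), each seen as a set of elements. -/
noncomputable def cycleFinsets (τ : Perm α) : Finset (Finset α) :=
  Finset.univ.image (cycleFinset τ)

/-- The total weight of the cycle of `τ` containing `x`. -/
noncomputable def cycleWeight (w : α → ℕ) (τ : Perm α) (x : α) : ℕ :=
  ∑ y ∈ cycleFinset τ x, w y

/-- The multiset of the total weights of the cycles of `τ`, fixed points included. -/
noncomputable def cycleWeights (w : α → ℕ) (τ : Perm α) : Multiset ℕ :=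
  (cycleFinsets τ).val.map fun O => ∑ y ∈ O, w y

theorem mem_cycleFinset {τ : Perm α} {x y : α} : y ∈ cycleFinset τ x ↔ τ.SameCycle x y := by
  simp [cycleFinset]

theorem self_mem_cycleFinset (τ : Perm α) (x : α) : x ∈ cycleFinset τ x :=
  mem_cycleFinset.2 (SameCycle.refl τ x)

theorem cycleFinset_eq_iff {τ : Perm α} {x y : α} :
    cycleFinset τ x = cycleFinset τ y ↔ τ.SameCycle x y := by
  constructor
  · intro h
    rw [← mem_cycleFinset, h]
    exact self_mem_cycleFinset τ y
  · intro h
    ext z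
    rw [mem_cycleFinset, mem_cycleFinset]
    exact ⟨h.symm.trans, h.trans⟩

theorem cycleFinset_mem_cycleFinsets (τ : Perm α) (x : α) : cycleFinset τ x ∈ cycleFinsets τ :=
  Finset.mem_image_of_mem _ (Finset.mem_univ x)

theorem eq_cycleFinset_of_mem {τ : Perm α} {O : Finset α} (hO : O ∈ cycleFinsets τ) {x : α}
    (hx : x ∈ O) : O = cycleFinset τ x := by
  obtain ⟨y, -, rfl⟩ := Finset.mem_image.1 hO
  exact cycleFinset_eq_iff.2 (mem_cycleFinset.1 hx)

theorem cycleWeights_eq_cons (w : α → ℕ) (τ : Perm α) (v : α) :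
    cycleWeights w τ = cycleWeight w τ v ::ₘ
      ((cycleFinsets τ).erase (cycleFinset τ v)).val.map fun O => ∑ y ∈ O, w y := by
  rw [cycleWeights, cycleWeight, ← Multiset.map_cons (fun O : Finset α => ∑ y ∈ O, w y),
    Finset.erase_val, Multiset.cons_erase (cycleFinset_mem_cycleFinsets τ v)]

/-- Changing the weight of a single element only affects the cycle of that element. -/
theorem cons_cycleWeights_of_eq_off {w w' : α → ℕ} {v : α} (h : ∀ x, x ≠ v → w x = w' x)
    (τ : Perm α) :
    cycleWeight w τ v ::ₘ cycleWeights w' τ = cycleWeight w' τ v ::ₘ cycleWeights w τ := by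
  rw [cycleWeights_eq_cons w τ v, cycleWeights_eq_cons w' τ v, Multiset.cons_swap]
  congr 2
  refine Multiset.map_congr rfl fun O hO => Finset.sum_congr rfl fun x hx => (h x ?_).symm
  rintro rfl
  have hO' : O ∈ (cycleFinsets τ).erase (cycleFinset τ x) := hO
  rw [Finset.mem_erase] at hO'
  exact hO'.1 (eq_cycleFinset_of_mem hO'.2 hx)

theorem cycleWeight_add_of_eq_off {w w' : α → ℕ} {v : α} (h : ∀ x, x ≠ v → w x = w' x)
    (τ : Perm α) : cycleWeight w τ v + w' v = cycleWeight w' τ v + w v := by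
  rw [cycleWeight, cycleWeight, ← Finset.add_sum_erase _ _ (self_mem_cycleFinset τ v),
    ← Finset.add_sum_erase _ w' (self_mem_cycleFinset τ v),
    Finset.sum_congr rfl fun x hx => h x (Finset.ne_of_mem_erase hx)]
  ring

theorem sum_cycleFinset_smul {A : Type*} [AddCommMonoid A] (w : α → ℕ) (τ : Perm α) (g : ℕ → A)
    {O : Finset α} (hO : O ∈ cycleFinsets τ) :
    ∑ j ∈ Finset.univ.filter (fun j => cycleFinset τ j = O), w j • g (cycleWeight w τ j) =
      (∑ y ∈ O, w y) • g (∑ y ∈ O, w y) := by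
  have hfil : Finset.univ.filter (fun j => cycleFinset τ j = O) = O := by
    ext j
    simp only [Finset.mem_filter, Finset.mem_univ, true_and]
    exact ⟨fun h => h ▸ self_mem_cycleFinset τ j, fun h => (eq_cycleFinset_of_mem hO h).symm⟩
  rw [hfil, Finset.sum_smul]
  refine Finset.sum_congr rfl fun j hj => ?_
  rw [cycleWeight, ← eq_cycleFinset_of_mem hO hj]

theorem sum_smul_cycleWeight {A : Type*} [AddCommMonoid A] (w : α → ℕ) (τ : Perm α) (g : ℕ → A) :
    ∑ j, w j • g (cycleWeight w τ j) = ((cycleWeights w τ).map fun m => m • g m).sum := by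
  rw [← Finset.sum_fiberwise_of_maps_to (g := cycleFinset τ) (t := cycleFinsets τ)
    fun j _ => cycleFinset_mem_cycleFinsets τ j, cycleWeights, Multiset.map_map]
  exact Finset.sum_congr rfl fun O hO => sum_cycleFinset_smul w τ g hO

theorem sum_smul_cycleWeight_of_not_sameCycle {A : Type*} [AddCommMonoid A] (w : α → ℕ)
    (τ : Perm α) (v : α) (g : ℕ → A) :
    ∑ j ∈ Finset.univ \ cycleFinset τ v, w j • g (cycleWeight w τ j) =
      ((((cycleFinsets τ).erase (cycleFinset τ v)).val.map fun O => ∑ y ∈ O, w y).map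
        fun m => m • g m).sum := by
  rw [← Finset.sum_fiberwise_of_maps_to (g := cycleFinset τ)
    (t := (cycleFinsets τ).erase (cycleFinset τ v)), Multiset.map_map]
  · refine Finset.sum_congr rfl fun O hO => ?_
    obtain ⟨hne, hO⟩ := Finset.mem_erase.1 hO
    rw [Function.comp_apply, ← sum_cycleFinset_smul w τ g hO]
    refine Finset.sum_congr ?_ fun _ _ => rfl
    ext j
    simp only [Finset.mem_filter, Finset.mem_sdiff, Finset.mem_univ, true_and, and_iff_right_iff_imp]
    rintro rfl hj
    exact hne (cycleFinset_eq_iff.2 (mem_cycleFinset.1 hj).symm)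
  · intro j hj
    refine Finset.mem_erase.2 ⟨fun h => ?_, cycleFinset_mem_cycleFinsets τ j⟩
    rw [Finset.mem_sdiff, ← h] at hj
    exact hj.2 (self_mem_cycleFinset τ j)

theorem cycleFinset_formPerm_mul_of_mem {l : List α} (hl : l.Nodup) {ρ : Perm α}
    (hρ : ∀ x ∈ l, ρ x = x) {x : α} (hx : x ∈ l) :
    cycleFinset (l.formPerm * ρ) x = l.toFinset := by
  have key : ∀ k : ℤ, ((l.formPerm * ρ) ^ k) x = (l.formPerm ^ k) x := fun k => by
    rw [(disjoint_formPerm hρ).commute.mul_zpow, Perm.mul_apply,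
      zpow_apply_eq_self_of_apply_eq_self (hρ x hx)]
  ext y
  rw [mem_cycleFinset, List.mem_toFinset]
  constructor
  · rintro ⟨k, rfl⟩
    rw [key]
    by_contra hy
    have := zpow_apply_eq_self_of_apply_eq_self (List.formPerm_apply_of_notMem hy) (-k)
    rw [zpow_neg, ← Perm.mul_apply, inv_mul_cancel, Perm.one_apply] at this
    exact hy (this ▸ hx)
  · intro hy
    obtain ⟨k, hk⟩ := sameCycle_formPerm hl hx hy
    exact ⟨k, (key k).trans hk⟩

theorem cycleFinset_formPerm_mul_of_notMem {l : List α} {ρ : Perm α}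
    (hρ : ∀ x ∈ l, ρ x = x) {x : α} (hx : x ∉ l) :
    cycleFinset (l.formPerm * ρ) x = cycleFinset ρ x := by
  have key : ∀ k : ℤ, ((l.formPerm * ρ) ^ k) x = (ρ ^ k) x := fun k => by
    rw [(disjoint_formPerm hρ).commute.eq, (disjoint_formPerm hρ).symm.commute.mul_zpow,
      Perm.mul_apply, zpow_apply_eq_self_of_apply_eq_self (List.formPerm_apply_of_notMem hx)]
  ext y
  simp only [mem_cycleFinset, SameCycle, key]

theorem cycleFinset_of_apply_eq_self {ρ : Perm α} {x : α} (hx : ρ x = x) :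
    cycleFinset ρ x = {x} := by
  ext y
  rw [mem_cycleFinset, Finset.mem_singleton]
  constructor
  · rintro ⟨k, rfl⟩
    exact zpow_apply_eq_self_of_apply_eq_self hx k
  · rintro rfl
    exact SameCycle.refl ρ y

theorem cycleWeight_formPerm_mul {l : List α} (hl : l.Nodup) {ρ : Perm α}
    (hρ : ∀ x ∈ l, ρ x = x) (w : α → ℕ) {x : α} (hx : x ∈ l) :
    cycleWeight w (l.formPerm * ρ) x = (l.map w).sum := by
  rw [cycleWeight, cycleFinset_formPerm_mul_of_mem hl hρ hx, List.sum_toFinset _ hl]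

theorem cycleWeights_formPerm_mul {l : List α} (hl : l.Nodup) (hne : l ≠ []) {ρ : Perm α}
    (hρ : ∀ x ∈ l, ρ x = x) (w : α → ℕ) :
    cycleWeights w (l.formPerm * ρ) + (l.map w : Multiset ℕ) =
      (l.map w).sum ::ₘ cycleWeights w ρ := by
  set X := (Finset.univ \ l.toFinset).image (cycleFinset ρ) with hX
  obtain ⟨v, hv⟩ := List.exists_mem_of_ne_nil l hne
  have huniv : (Finset.univ : Finset α) = l.toFinset ∪ (Finset.univ \ l.toFinset) := by simp
  have hdis : ∀ O ∈ X, ∀ x ∈ l, x ∉ O := by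
    intro O hO x hx hxO
    obtain ⟨y, hy, rfl⟩ := Finset.mem_image.1 hO
    rw [mem_cycleFinset] at hxO
    have := mem_cycleFinset.2 hxO.symm
    rw [cycleFinset_of_apply_eq_self (hρ x hx), Finset.mem_singleton] at this
    subst this
    simp [hx] at hy
  have h1 : cycleFinsets (l.formPerm * ρ) = insert l.toFinset X := by
    rw [cycleFinsets, huniv, Finset.image_union]
    have : l.toFinset.image (cycleFinset (l.formPerm * ρ)) = {l.toFinset} := by
      rw [Finset.image_congr (g := fun _ => l.toFinset) fun x hx =>
        cycleFinset_formPerm_mul_of_mem hl hρ (List.mem_toFinset.1 hx)]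
      exact Finset.image_const ⟨v, List.mem_toFinset.2 hv⟩ _
    rw [this, Finset.insert_eq, hX]
    congr 1
    exact Finset.image_congr fun x hx =>
      cycleFinset_formPerm_mul_of_notMem hρ fun h => by simp [h] at hx
  have h2 : cycleFinsets ρ = (l.toFinset.image fun x => {x}) ∪ X := by
    conv_lhs => rw [cycleFinsets, huniv, Finset.image_union]
    congr 1
    exact Finset.image_congr fun x hx =>
      cycleFinset_of_apply_eq_self (hρ x (List.mem_toFinset.1 hx))
  have h3 : l.toFinset ∉ X := fun h => hdis _ h v hv (List.mem_toFinset.2 hv)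
  have h4 : _root_.Disjoint (l.toFinset.image fun x => ({x} : Finset α)) X := by
    rw [Finset.disjoint_left]
    intro O hO hOX
    obtain ⟨x, hx, rfl⟩ := Finset.mem_image.1 hO
    exact hdis _ hOX x (List.mem_toFinset.1 hx) (Finset.mem_singleton_self x)
  rw [cycleWeights, cycleWeights, h1, h2, Finset.insert_val_of_notMem h3,
    ← Finset.disjUnion_eq_union _ _ h4, Finset.disjUnion_val, Multiset.map_add, Multiset.map_cons,
    Finset.image_val_of_injOn (Finset.singleton_injective.injOn), Multiset.map_map,
    List.sum_toFinset _ hl, Multiset.cons_add, add_comm, List.toFinset_val, hl.dedup]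
  simp

/-- Every permutation splits off the cycle through a given point. -/
theorem exists_eq_formPerm_mul (τ : Perm α) (v : α) :
    ∃ (l : List α) (ρ : Perm α), (v :: l).Nodup ∧ (∀ x ∈ v :: l, ρ x = x) ∧
      τ = (v :: l).formPerm * ρ := by
  by_cases hv : τ v = v
  · exact ⟨[], τ, by simp, by simpa using hv, by simp⟩
  · have hv' : v ∈ τ.support := mem_support.2 hv
    have hn := nodup_toList τ v
    have hmem : ∀ x, x ∈ toList τ v → τ.SameCycle v x := fun x hx => (mem_toList_iff.1 hx).1
    have hf := formPerm_toList τ v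
    have hh : ∀ a l, toList τ v = a :: l → a = v := fun a l h => by
      simpa [h] using toList_getElem_zero τ v hv'
    have hne : toList τ v ≠ [] := fun h => toList_eq_nil_iff.1 h hv'
    generalize toList τ v = L at hn hmem hf hh hne
    match L, hn, hmem, hf, hh, hne with
    | a :: l, hn, hmem, hf, hh, _ =>
      have : a = v := hh a l rfl
      subst this
      refine ⟨l, (τ.cycleOf a)⁻¹ * τ, hn, fun x hx => ?_, by rw [hf]; group⟩
      rw [Perm.mul_apply, Perm.inv_eq_iff_eq, SameCycle.cycleOf_apply (hmem x hx)]

theorem cycleWeights_swap_mul_append {v j : α} {l₁ l₂ : List α} {ρ : Perm α}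
    (h : (v :: l₁ ++ j :: l₂).Nodup) (hρ : ∀ x ∈ v :: l₁ ++ j :: l₂, ρ x = x) (w : α → ℕ) :
    (((v :: l₁).map w).sum + ((j :: l₂).map w).sum) ::ₘ
        cycleWeights w ((v :: l₁).formPerm * ((j :: l₂).formPerm * ρ)) =
      ((v :: l₁).map w).sum ::ₘ ((j :: l₂).map w).sum ::ₘ
        cycleWeights w ((v :: l₁ ++ j :: l₂).formPerm * ρ) := by
  obtain ⟨hn1, hn2, hd⟩ := List.nodup_append.1 h
  have e := cycleWeights_formPerm_mul h (by simp) hρ w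
  have e2 := cycleWeights_formPerm_mul hn2 (by simp)
    (fun x hx => hρ x (List.mem_append_right _ hx)) w
  have e1 := cycleWeights_formPerm_mul (ρ := (j :: l₂).formPerm * ρ) hn1 (by simp)
    (fun x hx => by
      rw [Perm.mul_apply, hρ x (List.mem_append_left _ hx),
        List.formPerm_apply_of_notMem fun hx' => hd x hx x hx' rfl]) w
  rw [List.map_append, List.sum_append, ← Multiset.coe_add] at e
  generalize cycleWeights w ((v :: l₁).formPerm * ((j :: l₂).formPerm * ρ)) = A at *
  generalize cycleWeights w ((v :: l₁ ++ j :: l₂).formPerm * ρ) = B at *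
  generalize cycleWeights w ((j :: l₂).formPerm * ρ) = C at *
  generalize cycleWeights w ρ = D at *
  generalize ((v :: l₁).map w).sum = s₁ at *
  generalize ((j :: l₂).map w).sum = s₂ at *
  generalize (((v :: l₁).map w : List ℕ) : Multiset ℕ) = K₁ at *
  generalize (((j :: l₂).map w : List ℕ) : Multiset ℕ) = K₂ at *
  simp only [← Multiset.singleton_add] at *
  have : (A + K₁) + K₂ = {s₁} + ({s₂} + D) := by rw [e1, add_assoc, e2]
  apply add_right_cancel (b := K₁ + K₂)
  calc _ = {s₁ + s₂} + (A + K₁ + K₂) := by abel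
    _ = {s₁} + ({s₂} + ({s₁ + s₂} + D)) := by rw [this]; abel
    _ = _ := by rw [← e]; abel

end CycleWeights

section SwapSums

open Equiv Equiv.Perm

variable {α : Type*}

theorem List.sum_smul_eq_sum_range {A : Type*} [AddCommMonoid A] (w : α → ℕ) (hw : ∀ x, w x ≤ 1)
    (l : List α) (g : α → A) (h : ℕ → ℕ → A)
    (hg : ∀ l₁ j l₂, l = l₁ ++ j :: l₂ → w j = 1 →
      g j = h (l₁.map w).sum ((j :: l₂).map w).sum) :
    (l.map fun j => w j • g j).sum =
      ∑ i ∈ Finset.range (l.map w).sum, h i ((l.map w).sum - i) := by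
  induction l generalizing h with
  | nil => simp
  | cons x l ih =>
    rcases Nat.le_one_iff_eq_zero_or_eq_one.1 (hw x) with hx | hx
    · have := ih h fun l₁ j l₂ e hj => by
        simpa [hx] using hg (x :: l₁) j l₂ (by simp [e]) hj
      simpa [hx] using this
    · have := ih (fun i k => h (i + 1) k) fun l₁ j l₂ e hj => by
        simpa [hx, add_comm] using hg (x :: l₁) j l₂ (by simp [e]) hj
      have h0 : g x = h 0 (1 + (l.map w).sum) := by simpa [hx] using hg [] x l (by simp) hx
      simp only [List.map_cons, List.sum_cons, this, hx, one_smul, h0]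
      rw [add_comm 1 (l.map w).sum, Finset.sum_range_succ', add_comm]
      simp

variable [DecidableEq α] [Fintype α]

theorem cycleWeights_swap_mul_of_not_sameCycle (w : α → ℕ) {τ : Perm α} {v j : α}
    (h : ¬ τ.SameCycle v j) :
    cycleWeight w (swap v j * τ) j = cycleWeight w τ v + cycleWeight w τ j ∧
      (cycleWeight w τ v + cycleWeight w τ j) ::ₘ cycleWeights w τ =
        cycleWeight w τ v ::ₘ cycleWeight w τ j ::ₘ cycleWeights w (swap v j * τ) := by
  obtain ⟨l₁, ρ, hn₁, hρ, hτ⟩ := exists_eq_formPerm_mul τ v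
  have hv := cycleFinset_formPerm_mul_of_mem hn₁ hρ List.mem_cons_self
  rw [← hτ] at hv
  have hj : j ∉ v :: l₁ := fun hj => h (mem_cycleFinset.1 (hv ▸ List.mem_toFinset.2 hj))
  obtain ⟨l₂, ρ', hn₂, hρ', hρρ'⟩ := exists_eq_formPerm_mul ρ j
  have hjρ := cycleFinset_formPerm_mul_of_mem hn₂ hρ' List.mem_cons_self
  rw [← hρρ'] at hjρ
  have hd : ∀ x ∈ v :: l₁, x ∉ j :: l₂ := by
    intro x hx hx'
    have hxj : ρ.SameCycle j x := mem_cycleFinset.1 (hjρ ▸ List.mem_toFinset.2 hx')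
    have := mem_cycleFinset.2 hxj.symm
    rw [cycleFinset_of_apply_eq_self (hρ x hx), Finset.mem_singleton] at this
    exact hj (this ▸ hx)
  have hn : (v :: l₁ ++ j :: l₂).Nodup :=
    List.nodup_append.2 ⟨hn₁, hn₂, fun a ha b hb e => hd a ha (e ▸ hb)⟩
  have hfix : ∀ x ∈ v :: l₁ ++ j :: l₂, ρ' x = x := by
    intro x hx
    rcases List.mem_append.1 hx with hx | hx
    · have := hρ x hx
      rw [hρρ', (disjoint_formPerm hρ').commute.eq, Perm.mul_apply,
        List.formPerm_apply_of_notMem (hd x hx)] at this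
      exact this
    · exact hρ' x hx
  have hswap : swap v j * τ = (v :: l₁ ++ j :: l₂).formPerm * ρ' := by
    rw [hτ, hρρ', ← mul_assoc (v :: l₁).formPerm, ← swap_mul_formPerm_append hn, ← mul_assoc,
      ← mul_assoc, swap_mul_self, one_mul]
  have hwv : cycleWeight w τ v = ((v :: l₁).map w).sum := by
    rw [hτ]
    exact cycleWeight_formPerm_mul hn₁ hρ w List.mem_cons_self
  have hwj : cycleWeight w τ j = ((j :: l₂).map w).sum := by
    rw [cycleWeight, hτ, cycleFinset_formPerm_mul_of_notMem hρ hj, hjρ, List.sum_toFinset _ hn₂]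
  rw [hwv, hwj, hswap, cycleWeight_formPerm_mul hn hfix w (by simp), List.map_append,
    List.sum_append]
  refine ⟨rfl, ?_⟩
  rw [← cycleWeights_swap_mul_append hn hfix w, ← hρρ', ← hτ]

theorem cycleWeights_swap_mul_of_split (w : α → ℕ) {τ ρ : Perm α} {v j : α} {l₁ l₂ : List α}
    (hn : (v :: l₁ ++ j :: l₂).Nodup) (hρ : ∀ x ∈ v :: l₁ ++ j :: l₂, ρ x = x)
    (hτ : τ = (v :: l₁ ++ j :: l₂).formPerm * ρ) :
    cycleWeight w (swap v j * τ) j = ((j :: l₂).map w).sum ∧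
      cycleWeight w τ v ::ₘ cycleWeights w (swap v j * τ) =
        ((v :: l₁).map w).sum ::ₘ ((j :: l₂).map w).sum ::ₘ cycleWeights w τ := by
  obtain ⟨hn₁, hn₂, hd⟩ := List.nodup_append.1 hn
  have hwv : cycleWeight w τ v = ((v :: l₁).map w).sum + ((j :: l₂).map w).sum := by
    rw [hτ, cycleWeight_formPerm_mul hn hρ w (by simp), List.map_append, List.sum_append]
  have hdis : Disjoint (v :: l₁).formPerm (j :: l₂).formPerm := disjoint_formPerm fun x hx =>
    List.formPerm_apply_of_notMem fun hx' => hd x hx x hx' rfl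
  have hswap : swap v j * τ = (v :: l₁).formPerm * ((j :: l₂).formPerm * ρ) := by
    rw [hτ, ← mul_assoc, swap_mul_formPerm_append hn, mul_assoc]
  constructor
  · rw [hswap, ← mul_assoc, hdis.commute.eq, mul_assoc]
    refine cycleWeight_formPerm_mul hn₂ (fun x hx => ?_) w List.mem_cons_self
    rw [Perm.mul_apply, hρ x (List.mem_append_right _ hx),
      List.formPerm_apply_of_notMem fun hx' => hd x hx' x hx rfl]
  · rw [hwv, hswap, cycleWeights_swap_mul_append hn hρ, ← hτ]

/-- The cycle weights of `swap v j * τ`, summed over all `j`: the swap either splits the cycle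
through `v` or merges it with another one. -/
theorem sum_smul_cycleWeights_swap_mul {A : Type*} [AddCommMonoid A] {w : α → ℕ}
    (hw : ∀ x, w x ≤ 1) (τ : Perm α) {v : α} (hv : w v = 0) (f : ℕ → Multiset ℕ → A)
    {R : Multiset ℕ} (hR : cycleWeights w τ = cycleWeight w τ v ::ₘ R) :
    ∑ j, w j • f (cycleWeight w (swap v j * τ) j) (cycleWeights w (swap v j * τ)) =
      ∑ i ∈ Finset.range (cycleWeight w τ v),
          f (cycleWeight w τ v - i) (i ::ₘ (cycleWeight w τ v - i) ::ₘ R) +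
        (R.map fun m => m • f (cycleWeight w τ v + m)
          ((cycleWeight w τ v + m) ::ₘ R.erase m)).sum := by
  have hR' : ((cycleFinsets τ).erase (cycleFinset τ v)).val.map (fun O => ∑ y ∈ O, w y) = R := by
    rw [cycleWeights_eq_cons w τ v, Multiset.cons_inj_right] at hR
    exact hR
  rw [← Finset.sum_sdiff (Finset.subset_univ (cycleFinset τ v)), add_comm]
  congr 1
  · obtain ⟨l, ρ, hn, hρ, hτ⟩ := exists_eq_formPerm_mul τ v
    have hcyc : cycleFinset τ v = (v :: l).toFinset := by
      rw [hτ]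
      exact cycleFinset_formPerm_mul_of_mem hn hρ List.mem_cons_self
    have hwv : cycleWeight w τ v = (l.map w).sum := by
      rw [cycleWeight, hcyc, List.sum_toFinset _ hn, List.map_cons, List.sum_cons, hv, zero_add]
    rw [hcyc, List.sum_toFinset _ hn, List.map_cons, List.sum_cons, hv, zero_smul, zero_add,
      List.sum_smul_eq_sum_range w hw l _ fun i k => f k (i ::ₘ k ::ₘ R), hwv]
    rintro l₁ j l₂ rfl -
    obtain ⟨h1, h2⟩ := cycleWeights_swap_mul_of_split w (l₁ := l₁) hn hρ hτ
    rw [h1]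
    congr 1
    rw [hR, List.map_cons, List.sum_cons, hv, zero_add, Multiset.cons_swap _ (cycleWeight w τ v),
      Multiset.cons_swap _ (cycleWeight w τ v), Multiset.cons_inj_right] at h2
    exact h2
  · rw [← hR', ← sum_smul_cycleWeight_of_not_sameCycle w τ v fun m =>
      f (cycleWeight w τ v + m) ((cycleWeight w τ v + m) ::ₘ
        (((cycleFinsets τ).erase (cycleFinset τ v)).val.map fun O => ∑ y ∈ O, w y).erase m)]
    refine Finset.sum_congr rfl fun j hj => ?_
    have hj' : ¬ τ.SameCycle v j := fun h =>
      (Finset.mem_sdiff.1 hj).2 (mem_cycleFinset.2 h)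
    obtain ⟨h1, h2⟩ := cycleWeights_swap_mul_of_not_sameCycle w hj'
    rw [h1, hR']
    have hmem : cycleWeight w τ j ∈ R := by
      rw [← hR']
      exact Multiset.mem_map_of_mem _ (Finset.mem_def.1 (Finset.mem_erase.2
        ⟨fun h => hj' (cycleFinset_eq_iff.1 h.symm), cycleFinset_mem_cycleFinsets τ j⟩))
    congr 2
    obtain ⟨R', hR''⟩ := Multiset.exists_cons_of_mem hmem
    rw [hR, Multiset.cons_swap, Multiset.cons_inj_right] at h2
    rw [hR''] at h2 ⊢
    rw [Multiset.erase_cons_head]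
    rw [Multiset.cons_swap, Multiset.cons_inj_right] at h2
    exact h2.symm

theorem cycleWeights_one_eq (τ : Perm α) :
    cycleWeights (fun _ => 1) τ =
      τ.cycleType + Multiset.replicate (Fintype.card α - τ.cycleType.sum) 1 := by
  have hu : (Finset.univ : Finset α) = τ.support ∪ τ.supportᶜ := by simp
  have h1 : τ.support.image (cycleFinset τ) = τ.cycleFactorsFinset.image Perm.support := by
    ext O
    simp only [Finset.mem_image]
    constructor
    · rintro ⟨x, hx, rfl⟩
      refine ⟨τ.cycleOf x, cycleOf_mem_cycleFactorsFinset_iff.2 hx, ?_⟩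
      ext y
      rw [mem_support_cycleOf_iff' (mem_support.1 hx), mem_cycleFinset]
    · rintro ⟨c, hc, rfl⟩
      obtain ⟨x, hx⟩ := (mem_cycleFactorsFinset_iff.1 hc).1.nonempty_support
      have hx' : x ∈ τ.support := mem_cycleFactorsFinset_support_le hc hx
      refine ⟨x, hx', ?_⟩
      rw [cycle_is_cycleOf hx hc]
      ext y
      rw [mem_support_cycleOf_iff' (mem_support.1 hx'), mem_cycleFinset]
  have h2 : (τ.supportᶜ).image (cycleFinset τ) = (τ.supportᶜ).image fun x => {x} :=
    Finset.image_congr fun x hx => cycleFinset_of_apply_eq_self (by simpa using hx)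
  have hd : _root_.Disjoint (τ.support.image (cycleFinset τ))
      ((τ.supportᶜ).image fun x => ({x} : Finset α)) := by
    rw [Finset.disjoint_left]
    rintro O hO hO'
    obtain ⟨x, hx, rfl⟩ := Finset.mem_image.1 hO
    obtain ⟨y, hy, e⟩ := Finset.mem_image.1 hO'
    have hxy := self_mem_cycleFinset τ x
    rw [← e, Finset.mem_singleton] at hxy
    exact Finset.mem_compl.1 hy (hxy ▸ hx)
  have hinj : Set.InjOn (Perm.support : Perm α → Finset α) τ.cycleFactorsFinset := by
    intro c hc d hd e
    by_contra hne
    have := (cycleFactorsFinset_pairwise_disjoint τ hc hd hne).disjoint_support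
    rw [e, disjoint_self] at this
    exact (mem_cycleFactorsFinset_iff.1 hd).1.nonempty_support.ne_empty this
  rw [cycleWeights, cycleFinsets, hu, Finset.image_union, h2, ← Finset.disjUnion_eq_union _ _ hd,
    Finset.disjUnion_val, Multiset.map_add, h1, Finset.image_val_of_injOn hinj,
    Finset.image_val_of_injOn Finset.singleton_injective.injOn, cycleType_def, Multiset.map_map,
    Multiset.map_map]
  congr 1
  · exact Multiset.map_congr rfl fun c _ => by simp
  · rw [← cycleType_def, sum_cycleType]
    simp [Finset.card_compl]

theorem sum_cycleWeights (w : α → ℕ) (τ : Perm α) : (cycleWeights w τ).sum = ∑ x, w x := by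
  have := sum_smul_cycleWeight w τ fun _ => 1
  simpa using this.symm

theorem cycleWeight_mem (w : α → ℕ) (τ : Perm α) (v : α) :
    cycleWeight w τ v ∈ cycleWeights w τ := by
  rw [cycleWeights_eq_cons w τ v]
  exact Multiset.mem_cons_self _ _

end SwapSums

section ShiftedBinomials

/-- The polynomial `binom(x + c, k)` for a natural number `k`. -/
noncomputable def shiftedBinom (c : ℤ) (k : ℕ) : ℚ[X] :=
  ((k.factorial : ℚ))⁻¹ • (descPochhammer ℚ k).comp (X + C (c : ℚ))

theorem binomPoly_natCast (c : ℤ) (k : ℕ) : binomPoly c k = shiftedBinom c k := by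
  simp [binomPoly, shiftedBinom]

theorem taylor_one_shiftedBinom (c : ℤ) (k : ℕ) :
    taylor 1 (shiftedBinom c k) = shiftedBinom (c + 1) k := by
  rw [shiftedBinom, shiftedBinom, map_smul, taylor_apply, comp_assoc]
  congr 2
  simp
  ring

theorem X_mul_shiftedBinom (c : ℤ) (k : ℕ) :
    X * shiftedBinom c k =
      ((k : ℚ[X]) + 1) * shiftedBinom c (k + 1) + ((k : ℚ[X]) - (c : ℚ[X])) * shiftedBinom c k := by
  have hk : ((k.factorial : ℚ)) ≠ 0 := by positivity
  have hf : ((k + 1 : ℕ) : ℚ) * (((k + 1).factorial : ℚ))⁻¹ = ((k.factorial : ℚ))⁻¹ := by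
    rw [Nat.factorial_succ]
    push_cast
    have : (k : ℚ) + 1 ≠ 0 := by positivity
    field_simp
  have hC : C (((k + 1 : ℕ) : ℚ)) * C ((((k + 1).factorial : ℚ))⁻¹) = C (((k.factorial : ℚ))⁻¹) := by
    rw [← C_mul, hf]
  rw [shiftedBinom, shiftedBinom, descPochhammer_succ_right, mul_comp, smul_eq_C_mul,
    smul_eq_C_mul]
  simp only [sub_comp, X_comp, natCast_comp] at *
  simp only [Nat.cast_add, Nat.cast_one, map_add, map_natCast, map_one, map_intCast] at *
  linear_combination -(descPochhammer ℚ k).comp (X + (c : ℚ[X])) * (X + (c : ℚ[X]) - k) * hC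

theorem shiftedBinom_succ_add_one (c : ℤ) (k : ℕ) :
    shiftedBinom (c + 1) (k + 1) = shiftedBinom c (k + 1) + shiftedBinom c k := by
  have hX : (X : ℚ[X]).comp (X + C (c : ℚ)) = X + (c : ℚ[X]) := by simp
  have e : shiftedBinom (c + 1) (k + 1) =
      ((((k + 1).factorial : ℚ))⁻¹) • ((X + (c : ℚ[X]) + 1) *
        (descPochhammer ℚ k).comp (X + C (c : ℚ))) := by
    rw [shiftedBinom, descPochhammer_succ_left, mul_comp, comp_assoc]
    congr 2
    · simp
      ring
    · congr 1
      simp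
      ring
  have h2 := X_mul_shiftedBinom c k
  have hf : ((((k + 1).factorial : ℚ))⁻¹) = ((k : ℚ) + 1)⁻¹ * ((k.factorial : ℚ))⁻¹ := by
    rw [Nat.factorial_succ]
    push_cast
    rw [mul_inv]
  have e' : ((k : ℚ[X]) + 1) * shiftedBinom (c + 1) (k + 1) =
      (X + (c : ℚ[X]) + 1) * shiftedBinom c k := by
    have h1 : (k : ℚ) + 1 ≠ 0 := by positivity
    have hC : ((k : ℚ[X]) + 1) * C (((k : ℚ) + 1)⁻¹) = 1 := by
      have : ((k : ℚ[X]) + 1) = C ((k : ℚ) + 1) := by simp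
      rw [this, ← C_mul, mul_inv_cancel₀ h1, C_1]
    rw [e, hf, shiftedBinom, smul_eq_C_mul, smul_eq_C_mul, C_mul]
    linear_combination (C ((k.factorial : ℚ))⁻¹ * ((X + (c : ℚ[X]) + 1) *
        (descPochhammer ℚ k).comp (X + C (c : ℚ)))) * hC
  have hne : ((k : ℚ[X]) + 1) ≠ 0 := by exact_mod_cast Nat.succ_ne_zero k
  apply mul_left_cancel₀ hne
  linear_combination e' + h2

theorem shiftedBinom_comp_neg_X (c : ℤ) (k : ℕ) :
    (shiftedBinom c k).comp (-X) = (-1 : ℚ) ^ k • shiftedBinom (k - 1 - c) k := by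
  have key : ∀ (k : ℕ) (c : ℚ), (descPochhammer ℚ k).comp (-X + C c) =
      (-1) ^ k * (descPochhammer ℚ k).comp (X + C (k - 1 - c)) := by
    intro k
    induction k with
    | zero => simp
    | succ k ih =>
      intro c
      rw [descPochhammer_succ_right, mul_comp, ih, ← descPochhammer_succ_right,
        descPochhammer_succ_left, mul_comp, comp_assoc]
      have : (X - 1 : ℚ[X]).comp (X + C ((k + 1 : ℕ) - 1 - c)) = X + C (k - 1 - c) := by
        simp
        ring
      rw [this]
      simp
      ring
  have := key k c
  rw [shiftedBinom, shiftedBinom, smul_comp, comp_assoc, smul_comm]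
  congr 1
  have h1 : (X + C (c : ℚ)).comp (-X) = -X + C (c : ℚ) := by simp
  rw [h1, this, smul_eq_C_mul]
  push_cast
  simp

/-- The value at `f` of the polynomial `q` in the operator `f(x) ↦ f(x + 1)`. -/
noncomputable def shiftEval (f : ℚ[X]) : ℚ[X] →ₗ[ℚ] ℚ[X] :=
  LinearMap.applyₗ f ∘ₗ (aeval (R := ℚ) (taylor (1 : ℚ))).toLinearMap

theorem shiftEval_apply (f q : ℚ[X]) : shiftEval f q = aeval (R := ℚ) (taylor (1 : ℚ)) q f := rfl

theorem shiftEval_mul (f p q : ℚ[X]) : shiftEval f (p * q) = shiftEval (shiftEval f q) p := by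
  simp [shiftEval_apply]

theorem shiftEval_X_mul (f q : ℚ[X]) : shiftEval f (X * q) = taylor 1 (shiftEval f q) := by
  simp [shiftEval_apply]

theorem shiftEval_X_pow_shiftedBinom (c : ℤ) (k m : ℕ) :
    shiftEval (shiftedBinom c k) (X ^ m) = shiftedBinom (c + m) k := by
  induction m with
  | zero => simp [shiftEval_apply]
  | succ m ih =>
    rw [pow_succ', shiftEval_X_mul, ih, taylor_one_shiftedBinom]
    push_cast
    rw [add_assoc]

theorem shiftEval_shiftedBinom (c : ℤ) (k : ℕ) (q : ℚ[X]) :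
    shiftEval (shiftedBinom c k) q = shiftEval (shiftedBinom c (k + 1)) ((X - 1) * q) := by
  rw [mul_comm, shiftEval_mul]
  congr 2
  rw [map_sub, ← pow_one X, shiftEval_X_pow_shiftedBinom, shiftEval_apply _ 1, Nat.cast_one,
    shiftedBinom_succ_add_one]
  simp

theorem shiftEval_shiftedBinom_add (c : ℤ) (k m : ℕ) (q : ℚ[X]) :
    shiftEval (shiftedBinom (c + m) k) q = shiftEval (shiftedBinom c k) (X ^ m * q) := by
  rw [mul_comm, shiftEval_mul, shiftEval_X_pow_shiftedBinom]

theorem X_mul_shiftEval (f q : ℚ[X]) :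
    X * shiftEval f q = shiftEval (X * f) q - shiftEval f (X * derivative q) := by
  induction q using Polynomial.induction_on' with
  | add p q hp hq =>
    simp only [map_add, mul_add, hp, hq]
    ring
  | monomial n a =>
    induction n generalizing a with
    | zero => simp [shiftEval_apply]
    | succ n ih =>
      have h : monomial (n + 1) a = X * monomial n a := by rw [X_mul_monomial]
      have hX : ∀ g : ℚ[X], X * taylor 1 g = taylor 1 (X * g) - taylor 1 g := fun g => by
        rw [taylor_mul]
        simp
        ring
      have hd : X * derivative (X * monomial n a) =
          X * monomial n a + X * (X * derivative (monomial n a)) := by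
        rw [derivative_mul, derivative_X]
        ring
      rw [h, hd, map_add, shiftEval_X_mul, hX, ih, map_sub]
      simp only [shiftEval_X_mul]
      ring

theorem shiftEval_mul_left_natCast (f q : ℚ[X]) (n : ℕ) :
    shiftEval ((n : ℚ[X]) * f) q = shiftEval f ((n : ℚ[X]) * q) := by
  rw [← nsmul_eq_mul, ← nsmul_eq_mul, map_nsmul, shiftEval_apply, map_nsmul, shiftEval_apply]

theorem shiftEval_mul_left_intCast (f q : ℚ[X]) (n : ℤ) :
    shiftEval ((n : ℚ[X]) * f) q = shiftEval f ((n : ℚ[X]) * q) := by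
  rw [← zsmul_eq_mul, ← zsmul_eq_mul, map_zsmul, shiftEval_apply, map_zsmul, shiftEval_apply]

/-- Multiplication by the variable, on polynomials in the shift operator applied to a binomial. -/
theorem X_mul_shiftEval_shiftedBinom (c : ℤ) (k : ℕ) (q : ℚ[X]) :
    X * shiftEval (shiftedBinom c (k + 1)) ((X - 1) * q) =
      shiftEval (shiftedBinom c (k + 1))
        (((k + 1 : ℚ[X]) + (k - c : ℚ[X]) * (X - 1)) * q - (X - 1) * (X * derivative q)) := by
  have h1 : X * shiftedBinom c k =
      ((k + 1 : ℕ) : ℚ[X]) * shiftedBinom c (k + 1) + ((k - c : ℤ) : ℚ[X]) * shiftedBinom c k := by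
    rw [X_mul_shiftedBinom]
    push_cast
    ring
  rw [← shiftEval_shiftedBinom, X_mul_shiftEval, h1, shiftEval_apply, map_add, ← shiftEval_apply,
    ← shiftEval_apply, shiftEval_mul_left_natCast, shiftEval_mul_left_intCast,
    shiftEval_shiftedBinom c k, shiftEval_shiftedBinom c k, ← map_add, ← map_sub]
  congr 1
  push_cast
  ring

end ShiftedBinomials

section CyclePolynomials

/-- The polynomial `X ^ m - 1`, except that the value at `m = 0` is `1`. -/
noncomputable def cyclePoly (m : ℕ) : ℚ[X] := if m = 0 then 1 else X ^ m - 1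

/-- The product of the polynomials `cyclePoly m` over the elements `m` of a multiset. -/
noncomputable def cycleProd (M : Multiset ℕ) : ℚ[X] := (M.map cyclePoly).prod

/-- The sum of `X ^ κ(σ * τ)` over the long cycles `σ` of a set with `k + 1` elements,
where `M` is the multiset of the numbers of elements of that set in the cycles of `τ`. -/
noncomputable def longCycleSum (k : ℕ) (M : Multiset ℕ) : ℚ[X] :=
  X ^ M.count 0 * ((k.factorial : ℚ[X]) * shiftEval (shiftedBinom 0 (k + 2)) (cycleProd M))

theorem cyclePoly_of_ne {m : ℕ} (hm : m ≠ 0) : cyclePoly m = X ^ m - 1 := if_neg hm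

theorem cyclePoly_zero : cyclePoly 0 = 1 := if_pos rfl

theorem cycleProd_cons (m : ℕ) (M : Multiset ℕ) :
    cycleProd (m ::ₘ M) = cyclePoly m * cycleProd M := by simp [cycleProd]

theorem X_mul_derivative_cyclePoly (m : ℕ) :
    X * derivative (cyclePoly m) = (m : ℚ[X]) * X ^ m := by
  rcases m with _ | m
  · simp [cyclePoly]
  · rw [cyclePoly_of_ne (Nat.succ_ne_zero m)]
    simp
    ring

theorem X_mul_derivative_cycleProd (M : Multiset ℕ) :
    X * derivative (cycleProd M) =
      (M.map fun m : ℕ => (m : ℚ[X]) * X ^ m * cycleProd (M.erase m)).sum := by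
  rw [cycleProd, derivative_prod, ← Multiset.sum_map_mul_left]
  congr 1
  refine Multiset.map_congr rfl fun m _ => ?_
  rw [← X_mul_derivative_cyclePoly, cycleProd]
  ring

theorem sum_map_natCast_mul_cycleProd_erase (M : Multiset ℕ) :
    (M.map fun m : ℕ => (m : ℚ[X]) * (X ^ m - 1) * cycleProd (M.erase m)).sum =
      (M.sum : ℚ[X]) * cycleProd M := by
  have : ∀ m ∈ M, (m : ℚ[X]) * (X ^ m - 1) * cycleProd (M.erase m) = (m : ℚ[X]) * cycleProd M := by
    intro m hm
    rcases eq_or_ne m 0 with rfl | h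
    · simp
    · conv_rhs => rw [← Multiset.cons_erase hm]
      rw [cycleProd_cons, cyclePoly_of_ne h, mul_assoc]
  rw [Multiset.map_congr rfl this, Multiset.sum_map_mul_right]
  congr 1
  exact (map_multiset_sum (Nat.castRingHom ℚ[X]) M).symm

theorem sum_map_natCast_mul_cycleProd_erase' (M : Multiset ℕ) :
    (M.map fun m : ℕ => (m : ℚ[X]) * cycleProd (M.erase m)).sum =
      X * derivative (cycleProd M) - (M.sum : ℚ[X]) * cycleProd M := by
  rw [← sum_map_natCast_mul_cycleProd_erase, X_mul_derivative_cycleProd, ← Multiset.sum_map_sub]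
  congr 1
  refine Multiset.map_congr rfl fun m _ => ?_
  ring

theorem sum_map_natCast_mul_pow_sub_mul_cycleProd_erase (M : Multiset ℕ) (f g : ℚ[X]) :
    (M.map fun m : ℕ => (m : ℚ[X]) * ((f * X ^ m - g) * cycleProd (M.erase m))).sum =
      (f - g) * (X * derivative (cycleProd M)) + g * ((M.sum : ℚ[X]) * cycleProd M) := by
  have h1 := sum_map_natCast_mul_cycleProd_erase' M
  have : ∀ m ∈ M, (m : ℚ[X]) * ((f * X ^ m - g) * cycleProd (M.erase m)) =
      f * ((m : ℚ[X]) * X ^ m * cycleProd (M.erase m)) -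
        g * ((m : ℚ[X]) * cycleProd (M.erase m)) := fun m _ => by ring
  rw [Multiset.map_congr rfl this, Multiset.sum_map_sub, Multiset.sum_map_mul_left,
    Multiset.sum_map_mul_left, h1, ← X_mul_derivative_cycleProd]
  ring

theorem X_sub_one_mul_sum_range (L : ℕ) :
    (X - 1 : ℚ[X]) * ∑ i ∈ Finset.range L, (X ^ i - 1) * (X ^ (L - i) - 1) =
      (L : ℚ[X]) * (X - 1) * (X ^ L + 1) - (X + 1) * (X ^ L - 1) := by
  have h : ∀ i ∈ Finset.range L, ((X : ℚ[X]) ^ i - 1) * (X ^ (L - i) - 1) =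
      (X ^ L + 1) - X ^ i - X * X ^ (L - 1 - i) := by
    intro i hi
    have hi' := Finset.mem_range.1 hi
    have e : L - i = (L - 1 - i) + 1 := by omega
    have e' : (X : ℚ[X]) ^ L = X ^ i * X ^ (L - i) := by rw [← pow_add]; congr 1; omega
    rw [e', ← pow_succ', ← e]
    ring
  rw [Finset.sum_congr rfl h, Finset.sum_sub_distrib, Finset.sum_sub_distrib, ← Finset.mul_sum,
    Finset.sum_range_reflect (fun i => (X : ℚ[X]) ^ i)]
  have hg := mul_geom_sum (X : ℚ[X]) L
  simp only [Finset.sum_const, Finset.card_range, nsmul_eq_mul]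
  linear_combination (-1 - X) * hg

theorem longCycleSum_zero_cons {k m : ℕ} {M : Multiset ℕ} (hm : m ≠ 0) :
    longCycleSum k (0 ::ₘ m ::ₘ M) = X ^ M.count 0 * ((k.factorial : ℚ[X]) *
      (X * shiftEval (shiftedBinom 0 (k + 2)) ((X ^ m - 1) * cycleProd M))) := by
  rw [longCycleSum, cycleProd_cons, cycleProd_cons, cyclePoly_zero, cyclePoly_of_ne hm, one_mul,
    Multiset.count_cons_self, Multiset.count_cons_of_ne hm.symm]
  ring

theorem longCycleSum_cons {k m : ℕ} {M : Multiset ℕ} (hm : m ≠ 0) :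
    longCycleSum k (m ::ₘ M) = X ^ M.count 0 * ((k.factorial : ℚ[X]) *
      shiftEval (shiftedBinom 0 (k + 2)) ((X ^ m - 1) * cycleProd M)) := by
  rw [longCycleSum, cycleProd_cons, cyclePoly_of_ne hm, Multiset.count_cons_of_ne hm.symm]

theorem longCycleSum_cons_cons {k l m : ℕ} {M : Multiset ℕ} (hl : l ≠ 0) (hm : m ≠ 0) :
    longCycleSum k (l ::ₘ m ::ₘ M) = X ^ M.count 0 * ((k.factorial : ℚ[X]) *
      shiftEval (shiftedBinom 0 (k + 2)) ((X ^ l - 1) * (X ^ m - 1) * cycleProd M)) := by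
  rw [longCycleSum_cons hl, cycleProd_cons, cyclePoly_of_ne hm, Multiset.count_cons_of_ne hm.symm,
    mul_assoc (X ^ l - 1)]

theorem sum_range_longCycleSum (k L : ℕ) (R : Multiset ℕ) :
    ∑ i ∈ Finset.range L, longCycleSum k (i ::ₘ (L - i) ::ₘ R) =
      X ^ R.count 0 * ((k.factorial : ℚ[X]) *
        (X * shiftEval (shiftedBinom 0 (k + 2)) ((X ^ L - 1) * cycleProd R) +
          shiftEval (shiftedBinom 0 (k + 2))
            ((∑ i ∈ Finset.range L, (X ^ i - 1) * (X ^ (L - i) - 1)) * cycleProd R))) := by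
  rcases L with _ | L
  · simp
  · have h1 : ∀ i ∈ Finset.range L, longCycleSum k ((i + 1) ::ₘ (L + 1 - (i + 1)) ::ₘ R) =
        X ^ R.count 0 * ((k.factorial : ℚ[X]) * shiftEval (shiftedBinom 0 (k + 2))
          ((X ^ (i + 1) - 1) * (X ^ (L + 1 - (i + 1)) - 1) * cycleProd R)) := fun i hi => by
      have := Finset.mem_range.1 hi
      rw [longCycleSum_cons_cons (Nat.succ_ne_zero i) (by omega)]
    rw [Finset.sum_range_succ', Finset.sum_congr rfl h1, Nat.sub_zero,
      longCycleSum_zero_cons (Nat.succ_ne_zero L), ← Finset.mul_sum, ← Finset.mul_sum, ← map_sum,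
      ← Finset.sum_mul, Finset.sum_range_succ' _ L, pow_zero, sub_self, zero_mul, add_zero]
    ring

theorem sum_map_longCycleSum (k : ℕ) (R : Multiset ℕ) (c : ℕ → ℕ)
    (hc : ∀ m ∈ R, m ≠ 0 → c m ≠ 0) :
    (R.map fun m => m • longCycleSum k (c m ::ₘ R.erase m)).sum =
      X ^ R.count 0 * ((k.factorial : ℚ[X]) * shiftEval (shiftedBinom 0 (k + 2))
        ((R.map fun m : ℕ => (m : ℚ[X]) * ((X ^ c m - 1) * cycleProd (R.erase m))).sum)) := by
  rw [map_multiset_sum, Multiset.map_map, ← Multiset.sum_map_mul_left, ← Multiset.sum_map_mul_left]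
  congr 1
  refine Multiset.map_congr rfl fun m hm => ?_
  rcases eq_or_ne m 0 with rfl | h
  · simp
  · rw [longCycleSum_cons (hc m hm h), Multiset.count_erase_of_ne h.symm, Function.comp_apply,
      ← nsmul_eq_mul m, map_nsmul]
    simp only [nsmul_eq_mul]
    ring

theorem longCycleSum_succ {k L : ℕ} {R : Multiset ℕ} (h : R.sum + L = k + 1) :
    longCycleSum (k + 1) ((L + 1) ::ₘ R) =
      ∑ i ∈ Finset.range L, longCycleSum k (i ::ₘ (L - i) ::ₘ R) +
        (R.map fun m => m • longCycleSum k ((L + m) ::ₘ R.erase m)).sum := by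
  have e1 := sum_map_natCast_mul_pow_sub_mul_cycleProd_erase R (X ^ L) 1
  have e2 := X_sub_one_mul_sum_range L
  have hd : X * derivative ((X ^ L - 1) * cycleProd R) =
      (L : ℚ[X]) * X ^ L * cycleProd R + (X ^ L - 1) * (X * derivative (cycleProd R)) := by
    rcases L with _ | L
    · simp
    · rw [derivative_mul]
      simp
      ring
  have hk : (k : ℚ[X]) + 1 = (R.sum : ℚ[X]) + L := by exact_mod_cast h.symm
  rw [sum_range_longCycleSum, sum_map_longCycleSum k R (L + ·) (fun m _ hm => by omega),
    longCycleSum_cons (Nat.succ_ne_zero L), ← mul_add, ← mul_add, Nat.factorial_succ]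
  simp only [pow_add _ L]
  rw [e1, shiftEval_shiftedBinom 0 (k + 2), X_mul_shiftEval_shiftedBinom,
    shiftEval_shiftedBinom 0 (k + 2), shiftEval_shiftedBinom 0 (k + 2), ← map_add, ← map_add]
  rw [Nat.cast_mul, mul_comm (((k + 1 : ℕ)) : ℚ[X]), mul_assoc ((k.factorial : ℕ) : ℚ[X]),
    ← nsmul_eq_mul (k + 1), ← map_nsmul, nsmul_eq_mul]
  congr 3
  rw [hd]
  push_cast at hk ⊢
  rw [pow_succ]
  linear_combination (-cycleProd R) * e2 + cycleProd R * (X - 1) * hk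


theorem sum_map_sq_mul_cycleProd_erase (M : Multiset ℕ) :
    (M.map fun m : ℕ => (m : ℚ[X]) * ((m : ℚ[X]) * X ^ m * cycleProd (M.erase m) +
      X ^ m * (X * derivative (cycleProd (M.erase m))))).sum =
      X * derivative (X * derivative (cycleProd M)) := by
  rw [X_mul_derivative_cycleProd M, map_multiset_sum, Multiset.map_map, ← Multiset.sum_map_mul_left]
  congr 1
  refine Multiset.map_congr rfl fun m _ => ?_
  rw [Function.comp_apply]
  rcases m with _ | m
  · simp
  · rw [derivative_mul, derivative_mul]
    simp
    ring

theorem sum_map_natCast_mul_derivative_cycleProd_erase (M : Multiset ℕ) :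
    (M.map fun m : ℕ => (m : ℚ[X]) * (X * derivative (cycleProd (M.erase m)))).sum =
      X * derivative (X * derivative (cycleProd M)) -
        (M.sum : ℚ[X]) * (X * derivative (cycleProd M)) := by
  have h := congrArg (fun q => X * derivative q) (sum_map_natCast_mul_cycleProd_erase' M)
  simp only [map_multiset_sum, Multiset.map_map, ← Multiset.sum_map_mul_left, derivative_sub] at h
  rw [derivative_mul (f := ((M.sum : ℕ) : ℚ[X])), derivative_natCast, zero_mul, zero_add] at h
  rw [mul_left_comm _ X, ← mul_sub, ← h]
  congr 1
  refine Multiset.map_congr rfl fun m _ => ?_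
  rw [Function.comp_apply, derivative_mul, derivative_natCast]
  ring

theorem shiftEval_shiftedBinom_zero (k : ℕ) (q : ℚ[X]) :
    shiftEval (shiftedBinom 0 (k + 2)) q =
      shiftEval (shiftedBinom (-2) (k + 3)) ((X - 1) * (X ^ 2 * q)) := by
  rw [← shiftEval_shiftedBinom, ← shiftEval_shiftedBinom_add]
  rfl

theorem X_mul_shiftEval_shiftedBinom_neg_two (k : ℕ) (q : ℚ[X]) :
    X * shiftEval (shiftedBinom (-2) (k + 3)) ((X - 1) * q) =
      shiftEval (shiftedBinom (-2) (k + 3))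
        ((((k + 3 : ℕ) + 1 : ℚ[X]) * X - 1) * q - (X - 1) * (X * derivative q)) := by
  rw [X_mul_shiftEval_shiftedBinom]
  congr 3
  push_cast
  ring

theorem smul_sum_longCycleSum {k L : ℕ} {B : Multiset ℕ} (hB : B.sum = k + 3)
    (h3 : ∀ m ∈ B, 3 ≤ m) (hL : L ∈ B) :
    L • (∑ i ∈ Finset.range (L - 1), longCycleSum k ((L - 1 - i - 1) ::ₘ i ::ₘ B.erase L) +
      ((B.erase L).map fun m =>
        m • longCycleSum k ((L - 1 + m - 1) ::ₘ (B.erase L).erase m)).sum) =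
      (k.factorial : ℚ[X]) * shiftEval (shiftedBinom (-2) (k + 3))
        ((2 * (((k + 3 : ℕ) + 1 : ℚ[X]) * X - 1) - 2 * (X - 1) - (X + 1)) *
            ((L : ℚ[X]) * X ^ L * cycleProd (B.erase L)) +
          X ^ 2 * (((k + 3 : ℕ) : ℚ[X]) * (X - 1) - 2 * (((k + 3 : ℕ) + 1 : ℚ[X]) * X - 1) +
            2 * (X - 1) + (X + 1)) * ((L : ℚ[X]) * cycleProd (B.erase L)) -
          (X - 1) * ((L : ℚ[X]) * ((L : ℚ[X]) * X ^ L * cycleProd (B.erase L) +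
            X ^ L * (X * derivative (cycleProd (B.erase L))))) +
          X ^ 2 * (X - 1) * ((L : ℚ[X]) * (X * derivative (cycleProd (B.erase L))))) := by
  have hcount : (B.erase L).count 0 = 0 := by
    rw [Multiset.count_eq_zero]
    exact fun h0 => absurd (h3 0 (Multiset.mem_of_mem_erase h0)) (by norm_num)
  generalize hn : ((k + 3 : ℕ) : ℚ[X]) = n
  obtain ⟨l, rfl⟩ : ∃ l, L = l + 2 := ⟨L - 2, by have := h3 L hL; omega⟩
  have hl : l ≠ 0 := by have := h3 _ hL; omega
  have hsum : ((B.erase (l + 2)).sum : ℚ[X]) = n - (l + 2) := by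
    have := Multiset.sum_erase hL
    rw [← hn, ← hB, ← this]
    push_cast
    ring
  have e1 := sum_map_natCast_mul_pow_sub_mul_cycleProd_erase (B.erase (l + 2)) (X ^ l) 1
  have e2 := X_sub_one_mul_sum_range l
  set D' := cycleProd (B.erase (l + 2)) with hD'
  have hfirst : ∑ i ∈ Finset.range (l + 2 - 1),
      longCycleSum k ((l + 2 - 1 - i - 1) ::ₘ i ::ₘ B.erase (l + 2)) =
      longCycleSum k (0 ::ₘ l ::ₘ B.erase (l + 2)) +
        ∑ i ∈ Finset.range l, longCycleSum k (i ::ₘ (l - i) ::ₘ B.erase (l + 2)) := by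
    rw [show l + 2 - 1 = l + 1 from rfl, Finset.sum_range_succ, add_comm]
    congr 1
    · congr 2
      omega
    · refine Finset.sum_congr rfl fun i _ => ?_
      rw [Multiset.cons_swap]
      congr 3
      omega
  have hm : ∀ m, l + 2 - 1 + m - 1 = l + m := fun m => by omega
  simp only [hm]
  rw [hfirst, longCycleSum_zero_cons hl, sum_range_longCycleSum,
    sum_map_longCycleSum k _ (l + ·) (fun m _ _ => by omega), hcount]
  simp only [pow_add _ l, pow_zero, one_mul]
  rw [e1, hsum, shiftEval_shiftedBinom_zero, shiftEval_shiftedBinom_zero,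
    shiftEval_shiftedBinom_zero, X_mul_shiftEval_shiftedBinom_neg_two, hn, ← mul_add, ← mul_add, ← map_add, ← map_add, ← map_add,
    nsmul_eq_mul, mul_left_comm, ← nsmul_eq_mul (l + 2), ← map_nsmul, nsmul_eq_mul]
  congr 2
  have hd : X * derivative (X ^ 2 * ((X ^ l - 1) * D')) =
      X ^ 2 * ((((l : ℚ[X]) + 2) * X ^ l - 2) * D' + (X ^ l - 1) * (X * derivative D')) := by
    obtain ⟨l, rfl⟩ := Nat.exists_eq_succ_of_ne_zero hl
    rw [derivative_mul, derivative_mul]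
    simp
    ring
  rw [hd]
  push_cast
  linear_combination ((l : ℚ[X]) + 2) * X ^ 2 * D' * e2

theorem sum_map_sum_longCycleSum {k : ℕ} {B : Multiset ℕ} (hB : B.sum = k + 3)
    (h3 : ∀ m ∈ B, 3 ≤ m) :
    (B.map fun L => L • (∑ i ∈ Finset.range (L - 1),
        longCycleSum k ((L - 1 - i - 1) ::ₘ i ::ₘ B.erase L) +
      ((B.erase L).map fun m =>
        m • longCycleSum k ((L - 1 + m - 1) ::ₘ (B.erase L).erase m)).sum)).sum =
      (k.factorial : ℚ[X]) *
        (X * (X - 1) * shiftEval (shiftedBinom (-2) (k + 1)) (cycleProd B) +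
          X * (X + 1) * shiftEval (shiftedBinom (-1) (k + 1)) (cycleProd B)) := by
  set D := cycleProd B with hD
  rw [Multiset.map_congr rfl fun L hL => smul_sum_longCycleSum hB h3 hL,
    Multiset.sum_map_mul_left, ← Function.comp_def (shiftEval _),
    ← Multiset.map_map, ← map_multiset_sum]
  congr 1
  rw [Multiset.sum_map_add, Multiset.sum_map_sub, Multiset.sum_map_add, Multiset.sum_map_mul_left,
    Multiset.sum_map_mul_left, Multiset.sum_map_mul_left, Multiset.sum_map_mul_left,
    ← X_mul_derivative_cycleProd, sum_map_natCast_mul_cycleProd_erase',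
    sum_map_sq_mul_cycleProd_erase, sum_map_natCast_mul_derivative_cycleProd_erase, hB, ← hD]
  generalize hn : ((k + 3 : ℕ) : ℚ[X]) = n
  have hs : shiftEval (shiftedBinom (-1) (k + 1)) D =
      shiftEval (shiftedBinom (-2) (k + 1)) (X * D) := by
    rw [← pow_one X, ← shiftEval_shiftedBinom_add]
    rfl
  have hr : X * (X - 1) * shiftEval (shiftedBinom (-2) (k + 1)) D +
      X * (X + 1) * shiftEval (shiftedBinom (-1) (k + 1)) D =
      X * (X * shiftEval (shiftedBinom (-2) (k + 3)) ((X - 1) * ((X - 1) * ((1 + X) * D)))) +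
        X * shiftEval (shiftedBinom (-2) (k + 3)) ((X - 1) * ((X - 1) * ((X - 1) * D))) := by
    rw [← shiftEval_shiftedBinom, ← shiftEval_shiftedBinom, ← shiftEval_shiftedBinom,
      ← shiftEval_shiftedBinom, hs, add_mul, sub_mul, one_mul, map_add, map_sub]
    ring
  have hXE := X_mul_shiftEval_shiftedBinom_neg_two k
  rw [hn] at hXE
  have hd : ∀ Y : ℚ[X], X * shiftEval (shiftedBinom (-2) (k + 3)) ((X - 1) * ((X - 1) * Y)) =
      shiftEval (shiftedBinom (-2) (k + 3))
        ((X - 1) * ((n * X - 1) * Y - (X - 1) * (X * derivative Y))) := fun Y => by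
    rw [hXE ((X - 1) * Y), derivative_mul]
    congr 1
    simp
    ring
  rw [hr, hd ((1 + X) * D), hd ((X - 1) * D), hXE ((n * X - 1) * ((1 + X) * D) -
    (X - 1) * (X * derivative ((1 + X) * D))), ← map_add]
  have hn0 : derivative n = 0 := by rw [← hn, derivative_natCast]
  refine congrArg (shiftEval (shiftedBinom (-2) (k + 3))) ?_
  simp only [derivative_mul, derivative_sub, derivative_add, derivative_X, derivative_one, derivative_zero, hn0]
  ring

end CyclePolynomials

section InclusionExclusion

variable {d : ℕ} {β : Fin d → ℕ}

theorem cycleProd_map_univ (hβ : ∀ i, β i ≠ 0) :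
    cycleProd (Multiset.map β Finset.univ.val) = ∏ i, ((X : ℚ[X]) ^ β i - 1) := by
  rw [cycleProd, Multiset.map_map]
  exact Finset.prod_congr rfl fun i _ => cyclePoly_of_ne (hβ i)

theorem prod_pow_sub_one (β : Fin d → ℕ) :
    ∏ i, ((X : ℚ[X]) ^ β i - 1) =
      ∑ S : Finset (Fin d), ((-1 : ℚ) ^ (d - S.card)) • (X : ℚ[X]) ^ (∑ i ∈ S, β i) := by
  simp only [sub_eq_add_neg]
  rw [Finset.prod_add, Finset.powerset_univ]
  refine Finset.sum_congr rfl fun S _ => ?_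
  rw [Finset.prod_const, Finset.prod_pow_eq_pow_sum, ← Finset.compl_eq_univ_sdiff,
    Finset.card_compl, Fintype.card_fin, smul_eq_C_mul, C_pow, C_neg, C_1, mul_comm]

theorem sum_smul_shiftedBinom (hβ : ∀ i, β i ≠ 0) (c : ℤ) (k : ℕ) :
    ∑ S : Finset (Fin d), ((-1 : ℚ) ^ (d - S.card)) • shiftedBinom (c + (∑ i ∈ S, β i : ℕ)) k =
      shiftEval (shiftedBinom c k) (cycleProd (Multiset.map β Finset.univ.val)) := by
  rw [cycleProd_map_univ hβ, prod_pow_sub_one, map_sum]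
  refine Finset.sum_congr rfl fun S _ => ?_
  rw [map_smul, shiftEval_X_pow_shiftedBinom]

theorem sum_smul_shiftedBinom_comp_neg_X (c : ℤ) (k : ℕ) :
    (∑ S : Finset (Fin d), ((-1 : ℚ) ^ (d - S.card)) •
        shiftedBinom (c + (∑ i ∈ S, β i : ℕ)) k).comp (-X) =
      (-1 : ℚ) ^ (k + d) • ∑ S : Finset (Fin d), ((-1 : ℚ) ^ (d - S.card)) •
        shiftedBinom (k - 1 - c - (∑ i, β i : ℕ) + (∑ i ∈ S, β i : ℕ)) k := by
  rw [sum_comp, Finset.smul_sum,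
    ← Equiv.sum_comp (Equiv.ofBijective _ (compl_bijective (α := Finset (Fin d))))]
  refine Finset.sum_congr rfl fun S _ => ?_
  have hS : S.card ≤ d := by simpa using S.card_le_univ
  have h1 : ∑ i, β i = ∑ i ∈ S, β i + ∑ i ∈ Sᶜ, β i := (Finset.sum_add_sum_compl S β).symm
  rw [Equiv.ofBijective_apply, smul_comp, shiftedBinom_comp_neg_X, Finset.card_compl,
    Fintype.card_fin, Nat.sub_sub_self hS, smul_smul, smul_smul, h1]
  congr 1
  · have : (-1 : ℚ) ^ (k + d) = (-1) ^ k * (-1) ^ S.card * (-1) ^ (d - S.card) := by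
      rw [← pow_add, ← pow_add]
      congr 1
      omega
    have h2 : (-1 : ℚ) ^ (d - S.card) * (-1) ^ (d - S.card) = 1 := by
      rw [← mul_pow]
      simp
    rw [this]
    linear_combination (-(-1 : ℚ) ^ k * (-1) ^ S.card) * h2
  · congr 1
    push_cast
    ring

end InclusionExclusion

section LongCycles

open Equiv Equiv.Perm

variable {α : Type*} [DecidableEq α]

/-- The long cycles on the elements of a list. -/
def longCycles : List α → Multiset (Perm α)
  | [] => 0
  | [_] => {1}
  | v :: j :: l =>
    ((j :: l : List α) : Multiset α).bind fun x => (longCycles (j :: l)).map (· * swap v x)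

theorem card_longCycles_cons (v : α) (l : List α) :
    Multiset.card (longCycles (v :: l)) = l.length.factorial := by
  induction l generalizing v with
  | nil => simp [longCycles]
  | cons j l ih =>
    rw [longCycles, Multiset.card_bind]
    simp [ih, Nat.factorial_succ]
    ring

theorem exists_formPerm_of_mem_longCycles {l : List α} (hl : l.Nodup) {σ : Perm α}
    (hσ : σ ∈ longCycles l) : ∃ l' : List α, l'.Perm l ∧ l'.formPerm = σ := by
  induction l generalizing σ with
  | nil => simp [longCycles] at hσ
  | cons v l ih =>
    cases l with
    | nil =>
      have : σ = 1 := by simpa [longCycles] using hσ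
      exact ⟨[v], List.Perm.refl _, by simp [this]⟩
    | cons j l =>
      rw [longCycles, Multiset.mem_bind] at hσ
      obtain ⟨x, hx, hσ⟩ := hσ
      obtain ⟨σ', hσ', rfl⟩ := Multiset.mem_map.1 hσ
      obtain ⟨l', hp, rfl⟩ := ih hl.of_cons hσ'
      obtain ⟨l₁, l₂, rfl⟩ := List.append_of_mem (hp.mem_iff.2 (Multiset.mem_coe.1 hx))
      have hrot : (l₁ ++ x :: l₂) ~r (l₂ ++ l₁ ++ [x]) := by
        simpa using (List.isRotated_append (l := l₁ ++ [x]) (l' := l₂))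
      refine ⟨l₂ ++ l₁ ++ [x, v], ?_, ?_⟩
      · refine List.Perm.trans ?_ (hp.cons v)
        refine List.Perm.trans ?_ (hrot.perm.symm.cons v)
        have := List.perm_append_singleton v (l₂ ++ l₁ ++ [x])
        simpa using this
      · rw [List.formPerm_append_pair, List.formPerm_eq_of_isRotated
          (hp.nodup_iff.2 hl.of_cons) hrot, swap_comm]

variable [Fintype α]

theorem sum_count_smul {A : Type*} [AddCommMonoid A] (l : List α) (g : α → A) :
    ∑ x, l.count x • g x = (l.map g).sum := by
  induction l with
  | nil => simp
  | cons a l ih =>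
    simp [List.count_cons, add_smul, Finset.sum_add_distrib, ih, add_comm, ite_smul]

theorem card_cycleWeights (w : α → ℕ) (τ : Perm α) :
    Multiset.card (cycleWeights w τ) = (cycleFinsets τ).card := by simp [cycleWeights]

theorem cycleWeights_zero (τ : Perm α) :
    cycleWeights (fun _ => 0) τ = Multiset.replicate (cycleFinsets τ).card 0 := by
  simp [cycleWeights]

theorem cycleWeight_zero (τ : Perm α) (x : α) : cycleWeight (fun _ => 0) τ x = 0 := by
  simp [cycleWeight]

theorem X_pow_card_cycleFinsets_eq_longCycleSum (v : α) (τ : Perm α) :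
    X ^ (cycleFinsets τ).card = longCycleSum 0 (cycleWeights (fun x => [v].count x) τ) := by
  have hoff : ∀ x, x ≠ v → [v].count x = 0 := fun x hx => by simp [hx.symm]
  have h1 := cycleWeight_add_of_eq_off hoff τ
  have h2 := cons_cycleWeights_of_eq_off hoff τ
  rw [cycleWeight_zero, add_zero, zero_add, List.count_singleton_self] at h1
  rw [cycleWeight_zero, cycleWeights_zero, h1] at h2
  have hc := congrArg (Multiset.count 0) h2
  have hp := congrArg cycleProd h2
  rw [Multiset.count_cons_of_ne (by norm_num), Multiset.count_replicate_self,
    Multiset.count_cons_self] at hc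
  rw [cycleProd_cons, cycleProd_cons, cyclePoly_zero, cyclePoly_of_ne one_ne_zero, one_mul] at hp
  have h3 : cycleProd (Multiset.replicate (cycleFinsets τ).card 0) = 1 := by
    simp [cycleProd, cyclePoly_zero]
  have h4 : shiftedBinom 0 1 = X := by simp [shiftedBinom]
  rw [longCycleSum, hc, ← hp, h3, pow_one, ← shiftEval_shiftedBinom, shiftEval_apply, map_one]
  simp [h4, pow_succ]

/-- The generating function of the number of cycles of `σ * τ` over the long cycles `σ` on the
elements of a list only depends on the number of these elements in each cycle of `τ`. -/
theorem sum_longCycles (v : α) (l : List α) (hl : (v :: l).Nodup) (τ : Perm α) :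
    ((longCycles (v :: l)).map fun σ => (X : ℚ[X]) ^ (cycleFinsets (σ * τ)).card).sum =
      longCycleSum l.length (cycleWeights (fun x => (v :: l).count x) τ) := by
  induction l generalizing v τ with
  | nil =>
    rw [longCycles, Multiset.map_singleton, Multiset.sum_singleton, one_mul]
    exact X_pow_card_cycleFinsets_eq_longCycleSum v τ
  | cons j l ih =>
    have hvl : v ∉ j :: l := (List.nodup_cons.1 hl).1
    have hv : (j :: l).count v = 0 := List.count_eq_zero.2 hvl
    have hw : ∀ x, (j :: l).count x ≤ 1 := List.nodup_iff_count_le_one.1 hl.of_cons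
    obtain ⟨R, hR⟩ := Multiset.exists_cons_of_mem
      (cycleWeight_mem (fun x => (j :: l).count x) τ v)
    have hoff : ∀ x, x ≠ v → (j :: l).count x = (v :: j :: l).count x := fun x hx => by
      rw [List.count_cons_of_ne hx.symm]
    have h1 := cycleWeight_add_of_eq_off hoff τ
    have h2 := cons_cycleWeights_of_eq_off hoff τ
    rw [hv, List.count_cons_self, hv, add_zero, zero_add] at h1
    rw [hR, Multiset.cons_swap, Multiset.cons_inj_right, ← h1] at h2
    have hsum : R.sum + cycleWeight (fun x => (j :: l).count x) τ v = l.length + 1 := by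
      have h3 := sum_cycleWeights (fun x => (j :: l).count x) τ
      have h4 := sum_count_smul (j :: l) fun _ => 1
      rw [hR, Multiset.sum_cons] at h3
      simp only [smul_eq_mul, mul_one, List.map_const', List.sum_replicate,
        List.length_cons] at h4
      omega
    rw [List.length_cons, h2, longCycleSum_succ hsum, longCycles, Multiset.map_bind,
      Multiset.sum_bind, Multiset.map_coe, Multiset.sum_coe,
      ← sum_smul_cycleWeights_swap_mul hw τ hv (fun _ M => longCycleSum l.length M) hR,
      ← sum_count_smul]
    refine Finset.sum_congr rfl fun x _ => ?_
    rw [← ih j hl.of_cons, Multiset.map_map]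
    simp only [Function.comp_def, mul_assoc]

end LongCycles

section PairSums

open Equiv Equiv.Perm

variable {α : Type*} [DecidableEq α] [Fintype α]

theorem count_toList_erase_erase (a b x : α) :
    ((Finset.univ.erase a).erase b).toList.count x = if x ≠ b ∧ x ≠ a then 1 else 0 := by
  rw [(Finset.nodup_toList _).count]
  simp

/-- The sum over `b ≠ a` of the generating functions for the long cycles avoiding `a` and `b`. -/
theorem sum_longCycleSum_swap_mul (k : ℕ) (τ : Perm α) (a : α) {L : ℕ} {R : Multiset ℕ}
    (hL : cycleWeight (fun _ => 1) τ a = L) (hR : cycleWeights (fun _ => 1) τ = L ::ₘ R) :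
    ∑ b ∈ Finset.univ.erase a, longCycleSum k (cycleWeights
        (fun x => ((Finset.univ.erase a).erase b).toList.count x) (swap a b * τ)) =
      ∑ i ∈ Finset.range (L - 1), longCycleSum k ((L - 1 - i - 1) ::ₘ i ::ₘ R) +
        (R.map fun m => m • longCycleSum k ((L - 1 + m - 1) ::ₘ R.erase m)).sum := by
  set w : α → ℕ := fun x => if x = a then 0 else 1 with hw
  have hwa : w a = 0 := if_pos rfl
  have hw1 : ∀ x, w x ≤ 1 := fun x => by
    rw [hw]
    dsimp only
    split_ifs <;> norm_num
  have hoff : ∀ x, x ≠ a → (fun _ => 1 : α → ℕ) x = w x := fun x hx => (if_neg hx).symm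
  have h1 := cycleWeight_add_of_eq_off hoff τ
  have h2 := cons_cycleWeights_of_eq_off hoff τ
  rw [hwa, hL, add_zero] at h1
  rw [hR, hL, Multiset.cons_swap, Multiset.cons_inj_right] at h2
  have hL' : cycleWeight w τ a = L - 1 := by omega
  have key := sum_smul_cycleWeights_swap_mul hw1 τ hwa
    (fun K M => longCycleSum k ((K - 1) ::ₘ M.erase K)) h2
  rw [hL', ← Finset.sum_erase (a := a) _ (by rw [hwa, zero_smul])] at key
  have hterm : ∀ b ∈ Finset.univ.erase a, longCycleSum k (cycleWeights
        (fun x => ((Finset.univ.erase a).erase b).toList.count x) (swap a b * τ)) =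
      w b • longCycleSum k ((cycleWeight w (swap a b * τ) b - 1) ::ₘ
        (cycleWeights w (swap a b * τ)).erase (cycleWeight w (swap a b * τ) b)) := by
    intro b hb
    have hba := Finset.ne_of_mem_erase hb
    have hwb : w b = 1 := if_neg hba
    have hoff' : ∀ x, x ≠ b →
        ((Finset.univ.erase a).erase b).toList.count x = w x := fun x hx => by
      rw [count_toList_erase_erase, hw]
      by_cases hxa : x = a <;> simp [hxa, hx, hba.symm]
    have h3 := cycleWeight_add_of_eq_off hoff' (swap a b * τ)
    have h4 := cons_cycleWeights_of_eq_off hoff' (swap a b * τ)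
    rw [hwb, count_toList_erase_erase, if_neg (by simp)] at h3
    obtain ⟨M, hM⟩ := Multiset.exists_cons_of_mem (cycleWeight_mem w (swap a b * τ) b)
    rw [hM, Multiset.cons_swap, Multiset.cons_inj_right] at h4
    rw [hwb, one_smul, hM, Multiset.erase_cons_head, ← h4]
    congr 2
    omega
  rw [Finset.sum_congr rfl hterm, key]
  congr 1
  · refine Finset.sum_congr rfl fun i _ => ?_
    rw [Multiset.cons_swap i, Multiset.erase_cons_head]
  · simp only [Multiset.erase_cons_head]

theorem sum_sum_longCycleSum_swap_mul (k : ℕ) (τ : Perm α) {B : Multiset ℕ}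
    (hB : cycleWeights (fun _ => 1) τ = B) :
    ∑ a, ∑ b ∈ Finset.univ.erase a, longCycleSum k (cycleWeights
        (fun x => ((Finset.univ.erase a).erase b).toList.count x) (swap a b * τ)) =
      (B.map fun L => L • (∑ i ∈ Finset.range (L - 1),
        longCycleSum k ((L - 1 - i - 1) ::ₘ i ::ₘ B.erase L) +
      ((B.erase L).map fun m =>
        m • longCycleSum k ((L - 1 + m - 1) ::ₘ (B.erase L).erase m)).sum)).sum := by
  have h := sum_smul_cycleWeight (fun _ => 1) τ fun L =>
    ∑ i ∈ Finset.range (L - 1), longCycleSum k ((L - 1 - i - 1) ::ₘ i ::ₘ B.erase L) +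
      ((B.erase L).map fun m =>
        m • longCycleSum k ((L - 1 + m - 1) ::ₘ (B.erase L).erase m)).sum
  rw [hB] at h
  rw [← h]
  refine Finset.sum_congr rfl fun a _ => ?_
  rw [one_smul]
  refine sum_longCycleSum_swap_mul k τ a rfl ?_
  rw [hB, Multiset.cons_erase]
  rw [← hB]
  exact cycleWeight_mem _ τ a

theorem cycleType_mul_swap_of_mem_longCycles {a b : α} (hab : a ≠ b) {σ : Perm α}
    (hσ : σ ∈ longCycles ((Finset.univ.erase a).erase b).toList) (hn : 4 ≤ Fintype.card α) :
    (σ * swap a b).cycleType = {2, Fintype.card α - 2} := by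
  obtain ⟨l, hp, rfl⟩ := exists_formPerm_of_mem_longCycles (Finset.nodup_toList _) hσ
  have hl : l.Nodup := hp.nodup_iff.2 (Finset.nodup_toList _)
  have hlen : l.length = Fintype.card α - 2 := by
    rw [hp.length_eq, Finset.length_toList, Finset.card_erase_of_mem (by simp [hab.symm]),
      Finset.card_erase_of_mem (by simp), Finset.card_univ]
    omega
  have hdis : Disjoint l.formPerm (swap a b) := disjoint_formPerm fun x hx => by
    have := hp.mem_iff.1 hx
    simp only [Finset.mem_toList, Finset.mem_erase] at this
    exact swap_apply_of_ne_of_ne this.2.1 this.1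
  have hne : ∀ x, l ≠ [x] := fun x hx => by
    rw [hx, List.length_singleton] at hlen
    omega
  rw [hdis.cycleType_mul, (List.isCycle_formPerm hl (by omega)).cycleType,
    List.support_formPerm_of_nodup l hl hne, List.toFinset_card_of_nodup hl, hlen,
    (isCycle_swap hab).cycleType, card_support_swap hab, add_comm]
  rfl

end PairSums

section PermClasses

open Equiv Equiv.Perm

variable {n : ℕ}

theorem fullCycleType_eq_cycleWeights (σ : Perm (Fin n)) :
    fullCycleType σ = cycleWeights (fun _ => 1) σ := by
  rw [cycleWeights_one_eq, Fintype.card_fin, fullCycleType]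

theorem numCycles_eq_card_cycleFinsets (σ : Perm (Fin n)) :
    numCycles σ = (cycleFinsets σ).card := by
  rw [numCycles, fullCycleType_eq_cycleWeights, card_cycleWeights]

theorem fullCycleType_filter (σ : Perm (Fin n)) :
    (fullCycleType σ).filter (2 ≤ ·) = σ.cycleType := by
  rw [fullCycleType, Multiset.filter_add, Multiset.filter_eq_self.2 fun m hm =>
    two_le_of_mem_cycleType hm, Multiset.filter_eq_nil.2, add_zero]
  intro m hm
  rw [Multiset.eq_of_mem_replicate hm]
  norm_num

theorem sum_permClass_eq_of_isConj {s t : Perm (Fin n)} (h : IsConj s t) (β : Multiset ℕ) :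
    ∑ ω ∈ permClass n β, (X : ℚ[X]) ^ numCycles (s * ω) =
      ∑ ω ∈ permClass n β, (X : ℚ[X]) ^ numCycles (t * ω) := by
  obtain ⟨c, rfl⟩ := isConj_iff.1 h
  have hconj : ∀ ω : Perm (Fin n), fullCycleType (c * ω * c⁻¹) = fullCycleType ω := fun ω => by
    rw [fullCycleType, cycleType_conj, fullCycleType]
  refine Finset.sum_equiv (MulAut.conj c).toEquiv (fun ω => ?_) fun ω _ => ?_
  · simp [permClass, hconj]
  · have : c * s * c⁻¹ * (MulAut.conj c).toEquiv ω = c * (s * ω) * c⁻¹ := by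
      simp [mul_assoc]
    rw [this, numCycles, numCycles, hconj]

theorem permClass_nonempty {β : Multiset ℕ} (hsum : β.sum = n) (h2 : ∀ m ∈ β, 2 ≤ m) :
    (permClass n β).Nonempty := by
  obtain ⟨g, hg⟩ := (exists_with_cycleType_iff (Fin n)).2
    ⟨by rw [Fintype.card_fin, hsum], h2⟩
  refine ⟨g, Finset.mem_filter.2 ⟨Finset.mem_univ g, ?_⟩⟩
  simp [fullCycleType, hg, hsum]

theorem factorial_mul_sum_permClass {k : ℕ} (hn : n = k + 3) (hk : 3 ≤ k) {α : Perm (Fin n)}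
    (hα : fullCycleType α = ({2, n - 2} : Multiset ℕ)) {a b : Fin n} (hab : a ≠ b)
    (β : Multiset ℕ) :
    (k.factorial : ℚ[X]) * ∑ ω ∈ permClass n β, X ^ numCycles (α * ω) =
      ∑ ω ∈ permClass n β, longCycleSum k (cycleWeights
        (fun x => ((Finset.univ.erase a).erase b).toList.count x) (swap a b * ω)) := by
  have hlen : ((Finset.univ.erase a).erase b).toList.length = k + 1 := by
    rw [Finset.length_toList, Finset.card_erase_of_mem (by simp [hab.symm]),
      Finset.card_erase_of_mem (by simp), Finset.card_univ, Fintype.card_fin, hn]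
    rfl
  have hconj : ∀ σ ∈ longCycles ((Finset.univ.erase a).erase b).toList,
      IsConj α (σ * swap a b) := fun σ hσ => by
    rw [isConj_iff_cycleType_eq, ← fullCycleType_filter, hα,
      cycleType_mul_swap_of_mem_longCycles hab hσ (by rw [Fintype.card_fin]; omega),
      Fintype.card_fin, Multiset.filter_eq_self]
    intro m hm
    simp only [Multiset.insert_eq_cons, Multiset.mem_cons, Multiset.mem_singleton] at hm
    omega
  have hnodup := Finset.nodup_toList ((Finset.univ.erase a).erase b)
  obtain ⟨v, l, hl⟩ := List.exists_cons_of_length_pos (by omega :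
    0 < ((Finset.univ.erase a).erase b).toList.length)
  rw [hl] at hlen hconj hnodup ⊢
  have hlk : l.length = k := by simpa using hlen
  have h1 := fun ω => sum_longCycles v l hnodup (swap a b * ω)
  rw [hlk] at h1
  simp only [← h1]
  rw [Finset.sum_eq_multiset_sum (permClass n β) fun ω => Multiset.sum _, Multiset.sum_map_sum_map,
    Multiset.map_congr rfl fun σ hσ => ?_, Multiset.map_const', Multiset.sum_replicate,
    card_longCycles_cons, hlk, nsmul_eq_mul]
  rw [← Finset.sum_eq_multiset_sum, sum_permClass_eq_of_isConj (hconj σ hσ)]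
  refine Finset.sum_congr rfl fun ω _ => ?_
  rw [numCycles_eq_card_cycleFinsets, mul_assoc]

theorem Pperm_eq_shiftEval {k : ℕ} (hn : n = k + 3) (hk : 3 ≤ k) {α : Perm (Fin n)}
    (hα : fullCycleType α = ({2, n - 2} : Multiset ℕ)) {β : Multiset ℕ} (hβ : β.sum = n)
    (h3 : ∀ m ∈ β, 3 ≤ m) :
    Pperm α β = X * (X - 1) * shiftEval (shiftedBinom (-2) (k + 1)) (cycleProd β) +
      X * (X + 1) * shiftEval (shiftedBinom (-1) (k + 1)) (cycleProd β) := by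
  have hpos : ((permClass n β).card : ℚ) ≠ 0 := by
    have := (permClass_nonempty hβ fun m hm => (by omega : 2 ≤ 3).trans (h3 m hm)).card_pos
    positivity
  set S : ℚ[X] := ∑ ω ∈ permClass n β, X ^ numCycles (α * ω) with hS
  set T : ℚ[X] := X * (X - 1) * shiftEval (shiftedBinom (-2) (k + 1)) (cycleProd β) +
      X * (X + 1) * shiftEval (shiftedBinom (-1) (k + 1)) (cycleProd β) with hT
  have h1 : ∑ a : Fin n, ∑ b ∈ Finset.univ.erase a, (k.factorial : ℚ[X]) * S =
      ∑ ω ∈ permClass n β, (k.factorial : ℚ[X]) * T := by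
    rw [Finset.sum_congr rfl fun a _ => Finset.sum_congr rfl fun b hb =>
      factorial_mul_sum_permClass hn hk hα (Finset.ne_of_mem_erase hb).symm β,
      Finset.sum_congr rfl fun a _ => Finset.sum_comm, Finset.sum_comm]
    refine Finset.sum_congr rfl fun ω hω => ?_
    rw [sum_sum_longCycleSum_swap_mul k ω (B := β), sum_map_sum_longCycleSum (hβ.trans hn) h3]
    rw [← fullCycleType_eq_cycleWeights]
    exact (Finset.mem_filter.1 hω).2
  have h2 : (n : ℚ[X]) * ((n : ℚ[X]) - 1) * S = ((permClass n β).card : ℚ[X]) * T := by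
    have hf : (k.factorial : ℚ[X]) ≠ 0 := by exact_mod_cast k.factorial_ne_zero
    apply mul_left_cancel₀ hf
    simp only [Finset.sum_const, Finset.card_univ, Fintype.card_fin, nsmul_eq_mul,
      Finset.card_erase_of_mem (Finset.mem_univ _)] at h1
    rw [Nat.cast_sub (by omega), Nat.cast_one] at h1
    linear_combination h1
  have hC : C (((permClass n β).card : ℚ)⁻¹) * ((permClass n β).card : ℚ[X]) = 1 := by
    rw [← C_eq_natCast, ← C_mul, inv_mul_cancel₀ hpos, C_1]
  rw [Pperm, ← hS, div_eq_mul_inv, C_mul, C_mul, C_sub, C_1, C_eq_natCast]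
  linear_combination C (((permClass n β).card : ℚ)⁻¹) * h2 + T * hC

end PermClasses

/-- with `G(x) = Σ_{S ⊆ [d]} (−1)^{d−|S|} binom(x−2+β_S, n−2)`,
`P_{[2,n−2],β}(x) = x(x−1)G(x) + (−1)^{n−d} x(x+1)G(−x)`. -/
theorem Pperm_parity_decomposition (n d : ℕ) (hn : 6 ≤ n) (β : Fin d → ℕ)
    (hβ3 : ∀ i, 3 ≤ β i) (hsum : ∑ i, β i = n)
    (α : Equiv.Perm (Fin n)) (hα : fullCycleType α = ({2, n - 2} : Multiset ℕ))
    (G : Polynomial ℚ)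
    (hG : G = ∑ S : Finset (Fin d), ((-1 : ℚ) ^ (d - S.card)) •
        binomPoly ((∑ i ∈ S, β i : ℤ) - 2) ((n : ℤ) - 2)) :
    Pperm α (Multiset.map β Finset.univ.val) =
      Polynomial.X * (Polynomial.X - 1) * G
        + ((-1 : ℚ) ^ (n - d)) •
            (Polynomial.X * (Polynomial.X + 1) * (G.comp (-Polynomial.X))) := by
  obtain ⟨k, rfl⟩ : ∃ k, n = k + 3 := ⟨n - 3, by omega⟩
  have hβ0 : ∀ i, β i ≠ 0 := fun i => by
    have := hβ3 i
    omega
  have hd : d ≤ k + 3 := by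
    rw [← hsum]
    calc d = ∑ _i : Fin d, 1 := by simp
      _ ≤ ∑ i, β i := Finset.sum_le_sum fun i _ => Nat.one_le_iff_ne_zero.2 (hβ0 i)
  have hP := Pperm_eq_shiftEval (k := k) rfl (by omega) hα (β := Multiset.map β Finset.univ.val)
    hsum fun m hm => by
      obtain ⟨i, -, rfl⟩ := Multiset.mem_map.1 hm
      exact hβ3 i
  have hG' : G = ∑ S : Finset (Fin d), ((-1 : ℚ) ^ (d - S.card)) •
      shiftedBinom (-2 + (∑ i ∈ S, β i : ℕ)) (k + 1) := by
    rw [hG]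
    refine Finset.sum_congr rfl fun S _ => ?_
    rw [← binomPoly_natCast]
    congr 2
    · push_cast
      ring
    · push_cast
      ring
  have h1 : G = shiftEval (shiftedBinom (-2) (k + 1))
      (cycleProd (Multiset.map β Finset.univ.val)) := by
    rw [hG', sum_smul_shiftedBinom hβ0]
  have h2 : G.comp (-X) = (-1 : ℚ) ^ (k + 1 + d) • shiftEval (shiftedBinom (-1) (k + 1))
      (cycleProd (Multiset.map β Finset.univ.val)) := by
    have hc : (((k + 1 : ℕ) : ℤ) - 1 - -2 - (∑ i, β i : ℕ)) = -1 := by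
      rw [hsum]
      push_cast
      ring
    rw [hG', sum_smul_shiftedBinom_comp_neg_X, hc, sum_smul_shiftedBinom hβ0]
  have h3 : (-1 : ℚ) ^ (k + 3 - d) * (-1) ^ (k + 1 + d) = 1 := by
    rw [← pow_add]
    exact Even.neg_one_pow ⟨k + 2, by omega⟩
  rw [hP, h2, ← h1, mul_smul_comm, smul_smul, h3, one_smul]
end
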